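/- arXiv:1606.01693 — 2 statements merged into one kernel-verified Lean document; each statement's English description precedes it below -/
import Mathlib

section
/- For every d ≥ 8 there exists a planar triangulation (3-connected plane graph in which every face is a triangle) with exactly d 3-cuts that is not traceable; moreover, such a triangulation can be found with scattering number at least 2, i.e., containing a vertex set X whose removal leaves at least |X| + 2 components. -/
open SimpleGraph Set

/-- A plane embedding of a simple graph: vertices are mapped to points of the plane,
edges to injective arcs, such that arcs meet only in common endpoints. -/
structure PlaneEmbedding {V : Type*} (G : SimpleGraph V) where
  vertexMap : V → ℝ × ℝ
  vertex_inj : Function.Injective vertexMap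
  edgeMap : ∀ ⦃a b : V⦄, G.Adj a b → C(unitInterval, ℝ × ℝ)
  edge_start : ∀ ⦃a b : V⦄ (h : G.Adj a b), edgeMap h 0 = vertexMap a
  edge_end : ∀ ⦃a b : V⦄ (h : G.Adj a b), edgeMap h 1 = vertexMap b
  edge_inj : ∀ ⦃a b : V⦄ (h : G.Adj a b), Function.Injective (edgeMap h)
  edge_symm : ∀ ⦃a b : V⦄ (h : G.Adj a b),
    Set.range (edgeMap h) = Set.range (edgeMap h.symm)
  edge_int : ∀ ⦃a b c d : V⦄ (h : G.Adj a b) (h' : G.Adj c d),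
    s(a, b) ≠ s(c, d) →
    Set.range (edgeMap h) ∩ Set.range (edgeMap h') ⊆
      vertexMap '' (({a, b} : Set V) ∩ {c, d})
  edge_no_vertex : ∀ ⦃a b : V⦄ (h : G.Adj a b) (x : V),
    vertexMap x ∈ Set.range (edgeMap h) → x = a ∨ x = b

variable {V : Type*}

/-- The subset of the plane covered by the drawing of the graph. -/
def PlaneEmbedding.drawing {G : SimpleGraph V} (E : PlaneEmbedding G) : Set (ℝ × ℝ) :=
  Set.range E.vertexMap ∪ ⋃ (a : V) (b : V) (h : G.Adj a b), Set.range (E.edgeMap h)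

/-- A face of a plane embedding: a connected component of the complement of the drawing. -/
def PlaneEmbedding.IsFace {G : SimpleGraph V} (E : PlaneEmbedding G)
    (F : Set (ℝ × ℝ)) : Prop :=
  ∃ x ∈ E.drawingᶜ, F = connectedComponentIn E.drawingᶜ x

/-- A face whose boundary is the union of the arcs of three mutually adjacent vertices. -/
def PlaneEmbedding.FaceIsTriangleOn {G : SimpleGraph V} (E : PlaneEmbedding G)
    (F : Set (ℝ × ℝ)) (a b c : V) : Prop :=
  ∃ (h1 : G.Adj a b) (h2 : G.Adj b c) (h3 : G.Adj c a),
    frontier F = Set.range (E.edgeMap h1) ∪ Set.range (E.edgeMap h2) ∪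
      Set.range (E.edgeMap h3)

/-- A face of a plane embedding is a triangle if it is bounded by three arcs of a 3-cycle. -/
def PlaneEmbedding.FaceIsTriangle {G : SimpleGraph V} (E : PlaneEmbedding G)
    (F : Set (ℝ × ℝ)) : Prop :=
  ∃ a b c : V, E.FaceIsTriangleOn F a b c

/-- `(a,b,c)` is a facial triangle of the embedding `E`. -/
def PlaneEmbedding.IsFacialTriangle {G : SimpleGraph V} (E : PlaneEmbedding G)
    (a b c : V) : Prop :=
  ∃ F : Set (ℝ × ℝ), E.IsFace F ∧ E.FaceIsTriangleOn F a b c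

/-- A graph is planar if it admits a plane embedding. -/
def IsPlanar (G : SimpleGraph V) : Prop := Nonempty (PlaneEmbedding G)

/-- A graph is `k`-connected if it has more than `k` vertices and removing fewer than
`k` vertices always leaves a connected graph. -/
def IsKConnected (k : ℕ) (G : SimpleGraph V) : Prop :=
  k < Nat.card V ∧ ∀ S : Set V, S.Finite → S.ncard < k → (G.induce Sᶜ).Connected

/-- A 3-cut: a set of 3 vertices whose removal disconnects the graph. -/
def IsThreeCut (G : SimpleGraph V) (S : Set V) : Prop :=
  S.ncard = 3 ∧ ¬ (G.induce Sᶜ).Preconnected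

/-- `C` is (the vertex set of) a connected component of `G - S`. -/
def IsCompOf (G : SimpleGraph V) (S : Set V) (C : Set V) : Prop :=
  C.Nonempty ∧ C ⊆ Sᶜ ∧ (G.induce C).Connected ∧
    ∀ a ∈ C, ∀ b ∈ Sᶜ, G.Adj a b → b ∈ C

/-- The edge closed component of `G - {u,v,w}` corresponding to the component `C`:
the graph induced on `C ∪ {u,v,w}` with the edges `uv`, `vw`, `wu` added. -/
def edgeClosedGraph (G : SimpleGraph V) (u v w : V) (C : Set V) :
    SimpleGraph ↥(C ∪ {u, v, w}) :=
  SimpleGraph.fromRel (fun a b =>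
    G.Adj a b ∨ ((a : V) ∈ ({u, v, w} : Set V) ∧ (b : V) ∈ ({u, v, w} : Set V)))

/-- No vertex labelling by truth values separates `A` in the subgraph of `G` induced on `A`. -/
def InseparableOn (G : SimpleGraph V) (A : Set V) : Prop :=
  ∀ P : V → Prop, (∀ x ∈ A, ∀ y ∈ A, G.Adj x y → (P x ↔ P y)) →
    ∀ x ∈ A, ∀ y ∈ A, P x ↔ P y

theorem preconnected_induce_iff_inseparableOn (G : SimpleGraph V) (A : Set V) :
    (G.induce A).Preconnected ↔ InseparableOn G A := by
  constructor
  · intro h P hP x hx y hy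
    obtain ⟨p⟩ := h ⟨x, hx⟩ ⟨y, hy⟩
    have key : ∀ {u v : A}, (G.induce A).Walk u v → (P u ↔ P v) := by
      intro u v p
      induction p with
      | nil => rfl
      | cons h _ ih => exact (hP _ (Subtype.coe_prop _) _ (Subtype.coe_prop _) h).trans ih
    exact key p
  · intro h x y
    have := h (fun z => ∃ hz : z ∈ A, (G.induce A).Reachable x ⟨z, hz⟩) ?_ x x.2 y y.2
    · exact (this.1 ⟨x.2, Reachable.refl _⟩).2
    · intro u hu v hv huv
      have huv' : (G.induce A).Adj ⟨u, hu⟩ ⟨v, hv⟩ := huv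
      exact ⟨fun ⟨_, r⟩ => ⟨hv, r.trans huv'.reachable⟩,
        fun ⟨_, r⟩ => ⟨hu, r.trans huv'.symm.reachable⟩⟩

/-- The graph obtained from `G` by adding a new vertex joined to the vertices in `t`. -/
def stackGraph (G : SimpleGraph V) (t : Finset V) : SimpleGraph (Option V) where
  Adj
    | some x, some y => G.Adj x y
    | some x, none => x ∈ t
    | none, some y => y ∈ t
    | none, none => False
  symm := ⟨by
    rintro (_ | x) (_ | y) h
    exacts [h, h, h, h.symm]⟩
  loopless := ⟨by
    rintro (_ | x) h
    exacts [h, G.irrefl h]⟩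

section Stack

variable {G : SimpleGraph V} {t : Finset V}

@[simp] theorem stackGraph_some_some {x y : V} :
    (stackGraph G t).Adj (some x) (some y) ↔ G.Adj x y := Iff.rfl

@[simp] theorem stackGraph_some_none {x : V} :
    (stackGraph G t).Adj (some x) none ↔ x ∈ t := Iff.rfl

@[simp] theorem stackGraph_none_some {x : V} :
    (stackGraph G t).Adj none (some x) ↔ x ∈ t := Iff.rfl

@[simp] theorem stackGraph_none_none : ¬ (stackGraph G t).Adj none none := id

theorem inseparableOn_stack_of_none_notMem {A' : Set (Option V)} (h : none ∉ A') :
    InseparableOn (stackGraph G t) A' ↔ InseparableOn G (some ⁻¹' A') := by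
  constructor
  · intro hc P hP x hx y hy
    refine hc (fun o => o.elim True P) ?_ (some x) hx (some y) hy
    rintro (_ | x) hx (_ | y) hy hxy
    · rfl
    · exact absurd hx h
    · exact absurd hy h
    · exact hP x hx y hy hxy
  · intro hc P hP
    rintro (_ | x) hx (_ | y) hy
    · rfl
    · exact absurd hx h
    · exact absurd hy h
    · exact hc (fun z => P (some z)) (fun x hx y hy hxy => hP _ hx _ hy hxy) x hx y hy

theorem inseparableOn_stack_of_mem (ht : G.IsClique t) {A' : Set (Option V)} {a : V}
    (ha : a ∈ t) (haA : some a ∈ A') :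
    InseparableOn (stackGraph G t) A' ↔ InseparableOn G (some ⁻¹' A') := by
  have hadj : ∀ x ∈ t, x = a ∨ G.Adj x a := fun x hx => by
    by_cases hxa : x = a
    · exact Or.inl hxa
    · exact Or.inr (ht hx ha hxa)
  constructor
  · intro hc P hP x hx y hy
    refine hc (fun o => P (o.getD a)) ?_ (some x) hx (some y) hy
    rintro (_ | x) hx (_ | y) hy hxy
    · rfl
    · rcases hadj y hxy with rfl | h
      · rfl
      · exact (hP _ hy _ haA h).symm
    · rcases hadj x hxy with rfl | h
      · rfl
      · exact hP _ hx _ haA h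
    · exact hP x hx y hy hxy
  · intro hc P hP
    have hs := hc (fun z => P (some z)) (fun x hx y hy hxy => hP _ hx _ hy hxy)
    have hn : ∀ y, some y ∈ A' → none ∈ A' → (P none ↔ P (some y)) := fun y hy h0 =>
      (hP _ h0 (some a) haA ha).trans (hs a haA y hy)
    rintro (_ | x) hx (_ | y) hy
    · rfl
    · exact hn y hy hx
    · exact (hn x hx hy).symm
    · exact hs x hx y hy

theorem exists_mem_notMem_of_ncard_lt (ht : t.card = 3) {S : Set V} (hS : S.Finite)
    (h : S.ncard < 3) : ∃ a ∈ t, a ∉ S := by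
  by_contra! hc
  have := Set.ncard_le_ncard (s := (t : Set V)) (t := S) hc hS
  rw [Set.ncard_coe_finset] at this
  omega

theorem isKConnected_iff_inseparableOn [Finite V] {k : ℕ} (G : SimpleGraph V) :
    IsKConnected k G ↔ k < Nat.card V ∧ ∀ S : Set V, S.ncard < k → InseparableOn G Sᶜ := by
  refine and_congr_right fun hk => ⟨fun h S hS => ?_, fun h S _ hS => ?_⟩
  · exact (preconnected_induce_iff_inseparableOn _ _).1 (h S S.toFinite hS).preconnected
  · have hne : (Sᶜ).Nonempty := by
      by_contra hc
      rw [Set.not_nonempty_iff_eq_empty, Set.compl_empty_iff] at hc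
      rw [hc, Set.ncard_univ] at hS
      omega
    have := hne.to_subtype
    exact ⟨(preconnected_induce_iff_inseparableOn _ _).2 (h S hS)⟩

theorem ncard_preimage_some_le [Finite V] (S : Set (Option V)) :
    (some ⁻¹' S).ncard ≤ S.ncard := by
  rw [← Set.ncard_image_of_injective _ (Option.some_injective V)]
  exact Set.ncard_le_ncard (Set.image_preimage_subset _ _) S.toFinite

theorem isKConnected_stackGraph [Finite V] (hG : IsKConnected 3 G) (ht : G.IsNClique 3 t) :
    IsKConnected 3 (stackGraph G t) := by
  rw [isKConnected_iff_inseparableOn] at hG ⊢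
  refine ⟨?_, fun S hS => ?_⟩
  · have := Finite.card_option (α := V)
    omega
  · have hS' := (ncard_preimage_some_le S).trans_lt hS
    obtain ⟨a, ha, haS⟩ := exists_mem_notMem_of_ncard_lt ht.card_eq (Set.toFinite _) hS'
    exact (inseparableOn_stack_of_mem ht.isClique ha haS).2 (hG.2 _ hS')

theorem isThreeCut_iff_inseparableOn {S : Set V} :
    IsThreeCut G S ↔ S.ncard = 3 ∧ ¬ InseparableOn G Sᶜ := by
  rw [IsThreeCut, preconnected_induce_iff_inseparableOn]

theorem not_isThreeCut_stackGraph_of_none_mem [Finite V] (hG : IsKConnected 3 G)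
    {S : Set (Option V)} (hS : none ∈ S) : ¬ IsThreeCut (stackGraph G t) S := by
  rw [isThreeCut_iff_inseparableOn]
  rintro ⟨h3, hc⟩
  refine hc ((inseparableOn_stack_of_none_notMem (by simpa using hS)).2 ?_)
  refine ((isKConnected_iff_inseparableOn G).1 hG).2 (some ⁻¹' S) ?_
  rw [← Set.ncard_image_of_injective _ (Option.some_injective V), ← h3]
  refine Set.ncard_lt_ncard ⟨Set.image_preimage_subset _ _, fun h => ?_⟩ S.toFinite
  simpa using h hS

theorem isThreeCut_stackGraph_image [Finite V] (ht : G.IsNClique 3 t) {S : Set V}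
    (hS : S ≠ t) : IsThreeCut (stackGraph G t) (some '' S) ↔ IsThreeCut G S := by
  rw [isThreeCut_iff_inseparableOn, isThreeCut_iff_inseparableOn,
    Set.ncard_image_of_injective _ (Option.some_injective V)]
  refine and_congr_right fun h3 => not_congr ?_
  obtain ⟨a, ha, haS⟩ : ∃ a ∈ t, a ∉ S := by
    by_contra! hc
    refine hS (Set.eq_of_subset_of_ncard_le (s := (t : Set V)) hc ?_).symm
    rw [Set.ncard_coe_finset, ht.card_eq, h3]
  rw [inseparableOn_stack_of_mem ht.isClique ha (by simpa using haS), Set.preimage_compl,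
    Set.preimage_image_eq _ (Option.some_injective V)]

theorem isThreeCut_stackGraph_image_self [Finite V] (hG : IsKConnected 3 G)
    (ht : t.card = 3) : IsThreeCut (stackGraph G t) (some '' (t : Set V)) := by
  rw [isThreeCut_iff_inseparableOn, Set.ncard_image_of_injective _ (Option.some_injective V),
    Set.ncard_coe_finset]
  refine ⟨ht, fun h => ?_⟩
  obtain ⟨y, hy⟩ : ∃ y, y ∉ t := by
    by_contra! hc
    have h1 := hG.1
    rw [← Set.ncard_univ, ← Set.eq_univ_of_forall (s := (t : Set V)) hc,
      Set.ncard_coe_finset] at h1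
    omega
  have := h (fun o => o = none) ?_ none (by simp) (some y) (by simpa using hy)
  · simp at this
  · rintro (_ | x) hx (_ | y) hy hxy
    · rfl
    · exact absurd hxy (by simpa using hy)
    · exact absurd hxy (by simpa using hx)
    · simp

theorem ncard_threeCuts_stackGraph [Finite V] (hG : IsKConnected 3 G) (ht : G.IsNClique 3 t)
    (hcut : ¬ IsThreeCut G t) :
    {S | IsThreeCut (stackGraph G t) S}.ncard = {S | IsThreeCut G S}.ncard + 1 := by
  have hinj : Function.Injective (fun S : Set V => some '' S) :=
    (Option.some_injective V).image_injective
  have heq : {S | IsThreeCut (stackGraph G t) S} =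
      insert (some '' (t : Set V)) ((fun S : Set V => some '' S) '' {S | IsThreeCut G S}) := by
    ext S'
    simp only [Set.mem_ofPred_eq, Set.mem_insert_iff, Set.mem_image]
    constructor
    · intro h
      have h0 : none ∉ S' := fun h0 => not_isThreeCut_stackGraph_of_none_mem hG h0 h
      have hS' : some '' (some ⁻¹' S') = S' := by
        refine Set.image_preimage_eq_of_subset ?_
        rintro (_ | x) hx
        · exact absurd hx h0
        · exact ⟨x, rfl⟩
      by_cases hS : some ⁻¹' S' = (t : Set V)
      · exact Or.inl (by rw [← hS, hS'])
      · refine Or.inr ⟨_, ?_, hS'⟩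
        rw [← hS'] at h
        exact (isThreeCut_stackGraph_image ht hS).1 h
    · rintro (rfl | ⟨S, h, rfl⟩)
      · exact isThreeCut_stackGraph_image_self hG ht.card_eq
      · refine (isThreeCut_stackGraph_image ht ?_).2 h
        rintro rfl
        exact hcut h
  rw [heq, Set.ncard_insert_of_notMem _ (Set.toFinite _), Set.ncard_image_of_injective _ hinj]
  rintro ⟨S, h, hS⟩
  rw [hinj hS] at h
  exact hcut h

end Stack

/-- Outside `X`, the labelling `f` is constant along edges and takes all values below `n`;
so `G - X` has at least `n` components. -/
def Scatters (G : SimpleGraph V) (X : Finset V) (n : ℕ) : Prop :=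
  ∃ f : V → ℕ, (∀ x ∉ X, ∀ y ∉ X, G.Adj x y → f x = f y) ∧ ∀ i < n, ∃ x ∉ X, f x = i

section Scatters

variable {G : SimpleGraph V} {X : Finset V} {n : ℕ}

theorem Scatters.stackGraph_of_subset {t : Finset V} (h : Scatters G X n) (ht : t ⊆ X) :
    Scatters (stackGraph G t) (X.map Function.Embedding.some) (n + 1) := by
  obtain ⟨f, hf, hn⟩ := h
  refine ⟨fun o => o.elim n f, ?_, fun i hi => ?_⟩
  · rintro (_ | x) hx (_ | y) hy hxy
    · rfl
    · exact absurd (ht hxy) (by simpa using hy)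
    · exact absurd (ht hxy) (by simpa using hx)
    · exact hf x (by simpa using hx) y (by simpa using hy) hxy
  · rcases Nat.lt_succ_iff_lt_or_eq.1 hi with hi | rfl
    · obtain ⟨x, hx, rfl⟩ := hn i hi
      exact ⟨some x, by simpa using hx, rfl⟩
    · exact ⟨none, by simp, rfl⟩

theorem Scatters.stackGraph_of_isClique {t : Finset V} (h : Scatters G X n)
    (ht : G.IsClique t) :
    Scatters (stackGraph G t) (X.map Function.Embedding.some) n := by
  by_cases htX : t ⊆ X
  · obtain ⟨f, hf, hn⟩ := h.stackGraph_of_subset htX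
    exact ⟨f, hf, fun i hi => hn i (by omega)⟩
  obtain ⟨f, hf, hn⟩ := h
  obtain ⟨a, hat, haX⟩ := Finset.not_subset.1 htX
  have hfa : ∀ x ∈ t, x ∉ X → f x = f a := fun x hx hxX => by
    by_cases hxa : x = a
    · rw [hxa]
    · exact hf x hxX a haX (ht hx hat hxa)
  refine ⟨fun o => f (o.getD a), ?_, fun i hi => ?_⟩
  · rintro (_ | x) hx (_ | y) hy hxy
    · rfl
    · exact (hfa y hxy (by simpa using hy)).symm
    · exact hfa x hxy (by simpa using hx)
    · exact hf x (by simpa using hx) y (by simpa using hy) hxy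
  · obtain ⟨x, hx, rfl⟩ := hn i hi
    exact ⟨some x, by simpa using hx, rfl⟩

theorem Scatters.le_card_connectedComponent [Finite V] (h : Scatters G X n) :
    n ≤ Nat.card (G.induce ((X : Set V)ᶜ : Set V)).ConnectedComponent := by
  obtain ⟨f, hf, hn⟩ := h
  have hwalk : ∀ (v w : ((X : Set V)ᶜ : Set V))
      (p : (G.induce ((X : Set V)ᶜ : Set V)).Walk v w), f v = f w := by
    intro v w p
    induction p with
    | nil => rfl
    | @cons u v _ h _ ih => exact (hf u u.2 v v.2 h).trans ih
  let g : (G.induce ((X : Set V)ᶜ : Set V)).ConnectedComponent → ℕ :=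
    ConnectedComponent.lift (fun v => f v) fun v w p _ => hwalk v w p
  have hsub : (Finset.range n : Set ℕ) ⊆ Set.range g := by
    intro i hi
    obtain ⟨x, hx, rfl⟩ := hn i (by simpa using hi)
    exact ⟨connectedComponentMk _ ⟨x, hx⟩, rfl⟩
  calc n = (Finset.range n : Set ℕ).ncard := by rw [Set.ncard_coe_finset, Finset.card_range]
    _ ≤ (Set.range g).ncard := Set.ncard_le_ncard hsub (Set.finite_range g)
    _ ≤ _ := by
      rw [← Set.image_univ, ← Set.ncard_univ]
      exact Set.ncard_image_le Set.finite_univ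

/-- A walk meets at most one more label class than it has visits to `X`. -/
theorem card_image_support_le [DecidableEq V] {f : V → ℕ}
    (hf : ∀ x ∉ X, ∀ y ∉ X, G.Adj x y → f x = f y) {u v : V} (p : G.Walk u v) :
    ((p.support.toFinset.filter (· ∉ X)).image f).card + (if u ∈ X then 1 else 0) ≤
      (p.support.filter (· ∈ X)).length + 1 := by
  induction p with
  | nil => 
    rename_i u
    by_cases h : u ∈ X <;> simp [h, Finset.filter_singleton]
  | @cons u v w h p ih =>
    by_cases hu : u ∈ X
    · simp only [Walk.support_cons, List.toFinset_cons, Finset.filter_insert, hu, if_true,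
        not_true_eq_false, if_false, List.filter_cons, decide_true, List.length_cons]
      omega
    · simp only [Walk.support_cons, List.toFinset_cons, Finset.filter_insert, hu, if_true,
        not_false_eq_true, if_false, List.filter_cons, decide_false, Finset.image_insert]
      by_cases hv : v ∈ X
      · rw [if_pos hv] at ih
        have := Finset.card_insert_le (f u) ((p.support.toFinset.filter (· ∉ X)).image f)
        simpa using this.trans ih
      · rw [Finset.insert_eq_of_mem]
        · simpa [hv] using ih
        · rw [hf u hu v hv h]
          exact Finset.mem_image_of_mem _ (by simp [hv])

theorem Scatters.not_isHamiltonian [DecidableEq V] (h : Scatters G X n)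
    (hX : X.card + 2 ≤ n) {a b : V} (p : G.Walk a b) : ¬ p.IsHamiltonian := by
  intro hp
  obtain ⟨f, hf, hn⟩ := h
  have h1 := card_image_support_le hf p
  have h2 : n ≤ ((p.support.toFinset.filter (· ∉ X)).image f).card := by
    rw [← Finset.card_range n]
    refine Finset.card_le_card fun i hi => ?_
    obtain ⟨x, hx, rfl⟩ := hn i (Finset.mem_range.1 hi)
    exact Finset.mem_image_of_mem _ (by simp [hx, hp.mem_support])
  have h3 : (p.support.filter (· ∈ X)).length ≤ X.card := by
    rw [← List.toFinset_card_of_nodup (hp.isPath.support_nodup.filter _)]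
    exact Finset.card_le_card fun x hx => by
      simpa using (List.mem_filter.1 (List.mem_toFinset.1 hx)).2
  omega

end Scatters

section Topology

theorem connectedComponentIn_eq_of_disjoint_frontier {α : Type*} [TopologicalSpace α]
    {S U : Set α} {x : α} (hU : IsPreconnected U) (ho : IsOpen U) (hsub : U ⊆ S)
    (hf : Disjoint (frontier U) S) (hx : x ∈ U) : connectedComponentIn S x = U := by
  refine Set.Subset.antisymm ?_ (hU.subset_connectedComponentIn hx hsub)
  refine isPreconnected_connectedComponentIn.subset_of_closure_inter_subset ho
    ⟨x, mem_connectedComponentIn (hsub hx), hx⟩ ?_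
  rintro y ⟨hyU, hyC⟩
  by_contra hy
  refine Set.disjoint_left.1 hf ?_ (connectedComponentIn_subset _ _ hyC)
  rw [ho.frontier_eq]
  exact ⟨hyU, hy⟩

theorem AffineBasis.frontier_convexHull_fin_three (b : AffineBasis (Fin 3) ℝ (ℝ × ℝ)) :
    frontier (convexHull ℝ (range b)) =
      segment ℝ (b 0) (b 1) ∪ segment ℝ (b 1) (b 2) ∪ segment ℝ (b 2) (b 0) := by
  have hcl : IsClosed (convexHull ℝ (range b)) := (finite_range b).isClosed_convexHull ℝ
  have hseg : ∀ i j k : Fin 3, i ≠ k → j ≠ k → ∀ x ∈ segment ℝ (b i) (b j), b.coord k x = 0 := by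
    intro i j k hik hjk x hx
    rw [segment_eq_image_lineMap] at hx
    obtain ⟨s, -, rfl⟩ := hx
    simp [AffineMap.apply_lineMap, b.coord_apply_ne hik.symm, b.coord_apply_ne hjk.symm]
  have hsub : ∀ i j : Fin 3, segment ℝ (b i) (b j) ⊆ convexHull ℝ (range b) := fun i j =>
    (convex_convexHull ℝ _).segment_subset (subset_convexHull ℝ _ ⟨i, rfl⟩)
      (subset_convexHull ℝ _ ⟨j, rfl⟩)
  rw [hcl.frontier_eq, b.interior_convexHull]
  ext x
  constructor
  · rintro ⟨hx, hx'⟩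
    rw [b.convexHull_eq_nonneg_coord] at hx
    replace hx : ∀ i, 0 ≤ b.coord i x := hx
    have h1 := b.sum_coord_apply_eq_one x
    have h2 := b.linear_combination_coord_eq_self x
    simp only [Fin.sum_univ_three] at h1 h2
    obtain ⟨i, hi⟩ : ∃ i, b.coord i x ≤ 0 := by
      by_contra! hc
      exact hx' hc
    have hi0 := le_antisymm hi (hx i)
    fin_cases i
    · refine Or.inl (Or.inr ⟨_, _, hx 1, hx 2, ?_, ?_⟩)
      · simpa [show b.coord 0 x = 0 from hi0] using h1
      · simpa [show b.coord 0 x = 0 from hi0] using h2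
    · refine Or.inr ⟨_, _, hx 2, hx 0, ?_, ?_⟩
      · simpa [show b.coord 1 x = 0 from hi0, add_comm] using h1
      · simpa [show b.coord 1 x = 0 from hi0, add_comm] using h2
    · refine Or.inl (Or.inl ⟨_, _, hx 0, hx 1, ?_, ?_⟩)
      · simpa [show b.coord 2 x = 0 from hi0] using h1
      · simpa [show b.coord 2 x = 0 from hi0] using h2
  · rintro ((hx | hx) | hx)
    · exact ⟨hsub _ _ hx, fun h => (h 2).ne' (hseg 0 1 2 (by decide) (by decide) x hx)⟩
    · exact ⟨hsub _ _ hx, fun h => (h 0).ne' (hseg 1 2 0 (by decide) (by decide) x hx)⟩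
    · exact ⟨hsub _ _ hx, fun h => (h 1).ne' (hseg 2 0 1 (by decide) (by decide) x hx)⟩

theorem Convex.frontier_interior_eq {s : Set (ℝ × ℝ)} (hs : Convex ℝ s)
    (hne : (interior s).Nonempty) : frontier (interior s) = frontier s := by
  rw [frontier, frontier, interior_interior,
    hs.closure_interior_eq_closure_of_nonempty_interior hne]

/-- The closed triangle with corners `(0, 0)`, `(1, 0)` and `(0, 1)`. -/
def baseTriangle : Set (ℝ × ℝ) := {q | 0 ≤ q.1 ∧ 0 ≤ q.2 ∧ q.1 + q.2 ≤ 1}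

theorem baseTriangle_eq_convexHull :
    baseTriangle = convexHull ℝ (range ![((0 : ℝ), (0 : ℝ)), (1, 0), (0, 1)]) := by
  apply Set.Subset.antisymm
  · rintro ⟨x, y⟩ ⟨hx, hy, hxy⟩
    have hmem : ∀ i, ![((0 : ℝ), (0 : ℝ)), (1, 0), (0, 1)] i ∈
        convexHull ℝ (range ![((0 : ℝ), (0 : ℝ)), (1, 0), (0, 1)]) :=
      fun i => subset_convexHull ℝ _ ⟨i, rfl⟩
    have := (convex_convexHull ℝ (range ![((0 : ℝ), (0 : ℝ)), (1, 0), (0, 1)])).sum_mem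
      (t := Finset.univ) (w := ![1 - x - y, x, y]) (z := ![((0 : ℝ), (0 : ℝ)), (1, 0), (0, 1)])
      ?_ ?_ fun i _ => hmem i
    · simpa [Fin.sum_univ_three] using this
    · intro i _
      fin_cases i
      · simp at hxy ⊢
        linarith
      · exact hx
      · exact hy
    · simp [Fin.sum_univ_three]
      ring
  · refine convexHull_min ?_ ?_
    · rintro _ ⟨i, rfl⟩
      fin_cases i <;> simp [baseTriangle]
    · rintro ⟨x, y⟩ ⟨hx, hy, hxy⟩ ⟨x', y'⟩ ⟨hx', hy', hxy'⟩ a b ha hb hab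
      simp only [baseTriangle, Set.mem_ofPred_eq, Prod.smul_mk, Prod.mk_add_mk, smul_eq_mul] at *
      refine ⟨by positivity, by positivity, ?_⟩
      nlinarith

theorem isPreconnected_compl_baseTriangle : IsPreconnected baseTriangleᶜ := by
  have heq : baseTriangleᶜ =
      ({q : ℝ × ℝ | q.1 < 0} ∪ {q | q.2 < 0}) ∪ {q | 1 < q.1 + q.2} := by
    ext ⟨x, y⟩
    simp only [baseTriangle, Set.mem_compl_iff, Set.mem_ofPred_eq, Set.mem_union, not_and_or,
      not_le, or_assoc]
  have h1 : Convex ℝ {q : ℝ × ℝ | q.1 < 0} :=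
    convex_halfSpace_lt (IsLinearMap.mk (fun _ _ => rfl) fun _ _ => rfl) 0
  have h2 : Convex ℝ {q : ℝ × ℝ | q.2 < 0} :=
    convex_halfSpace_lt (IsLinearMap.mk (fun _ _ => rfl) fun _ _ => rfl) 0
  have h3 : Convex ℝ {q : ℝ × ℝ | 1 < q.1 + q.2} :=
    convex_halfSpace_gt (LinearMap.isLinear (LinearMap.fst ℝ ℝ ℝ + LinearMap.snd ℝ ℝ ℝ)) 1
  rw [heq]
  refine (h1.isPreconnected.union (-1, -1) ?_ ?_ h2.isPreconnected).union (-1, 3) ?_ ?_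
    h3.isPreconnected <;> norm_num

theorem range_lineMap_unitInterval (p q : ℝ × ℝ) :
    Set.range (fun s : unitInterval => AffineMap.lineMap p q (s : ℝ)) = segment ℝ p q := by
  rw [segment_eq_image_lineMap, Set.image_eq_range]

theorem convex_baseTriangle : Convex ℝ baseTriangle :=
  baseTriangle_eq_convexHull ▸ convex_convexHull ℝ _

theorem isClosed_baseTriangle : IsClosed baseTriangle :=
  baseTriangle_eq_convexHull ▸ (finite_range _).isClosed_convexHull ℝ

theorem affineIndependent_baseTriangle :
    AffineIndependent ℝ ![((0 : ℝ), (0 : ℝ)), (1, 0), (0, 1)] := by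
  rw [affineIndependent_iff_of_fintype]
  intro w hw h
  rw [Finset.weightedVSub_eq_linear_combination _ hw] at h
  simp only [Fin.sum_univ_three, Matrix.cons_val, Prod.smul_mk, smul_eq_mul, mul_zero, mul_one,
    Prod.mk_add_mk, Prod.mk_eq_zero, zero_add, add_zero] at hw h
  rw [Fin.forall_fin_succ, Fin.forall_fin_two]
  exact ⟨by linarith, h.1, h.2⟩

/-- Three affinely independent points of the plane form an affine basis. -/
noncomputable def AffineIndependent.planeBasis {p : Fin 3 → ℝ × ℝ} (hp : AffineIndependent ℝ p) :
    AffineBasis (Fin 3) ℝ (ℝ × ℝ) :=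
  ⟨p, hp, by rw [hp.affineSpan_eq_top_iff_card_eq_finrank_add_one]; simp⟩

@[simp] theorem AffineIndependent.coe_planeBasis {p : Fin 3 → ℝ × ℝ}
    (hp : AffineIndependent ℝ p) : ⇑hp.planeBasis = p := rfl

end Topology

/-- A nonnegative weight function supported on one of the sets in `T`. -/
def IsCellWeight (T : Set (Finset V)) (w : V → ℝ) : Prop :=
  (∀ v, 0 ≤ w v) ∧ ∃ t ∈ T, ∀ v ∉ t, w v = 0

/-- A straight-line triangulation of `baseTriangle` with underlying graph `G`: every point of the
triangle is a weighted mean of the vertices of a facet, with unique weights. -/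
structure StraightTriangulation [Fintype V] (G : SimpleGraph V) where
  pos : V → ℝ × ℝ
  facets : Set (Finset V)
  isNClique : ∀ t ∈ facets, G.IsNClique 3 t
  exists_vertex_mem : ∀ v, ∃ t ∈ facets, v ∈ t
  exists_edge_mem : ∀ ⦃a b⦄, G.Adj a b → ∃ t ∈ facets, a ∈ t ∧ b ∈ t
  weight_unique : ∀ w₁ w₂ : V → ℝ, IsCellWeight facets w₁ → IsCellWeight facets w₂ →
    ∑ v, w₁ v = ∑ v, w₂ v → ∑ v, w₁ v • pos v = ∑ v, w₂ v • pos v → w₁ = w₂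
  pos_mem : ∀ v, pos v ∈ baseTriangle
  exists_weight : ∀ q ∈ baseTriangle, ∃ w : V → ℝ, IsCellWeight facets w ∧
    ∑ v, w v = 1 ∧ ∑ v, w v • pos v = q
  corner : Fin 3 → V
  pos_corner : ∀ i, pos (corner i) = ![((0 : ℝ), (0 : ℝ)), (1, 0), (0, 1)] i
  corner_adj : ∀ i j, i ≠ j → G.Adj (corner i) (corner j)

theorem sum_extend [Fintype V] {M : Type*} [AddCommMonoid M] {e : Fin 3 → V}
    (he : Function.Injective e)
    (c : Fin 3 → ℝ) (g : V → ℝ → M) (hg : ∀ v, g v 0 = 0) :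
    ∑ v, g v (Function.extend e c 0 v) = ∑ i, g (e i) (c i) := by
  classical
  rw [← Finset.sum_subset (Finset.subset_univ (Finset.univ.image e)),
    Finset.sum_image he.injOn]
  · exact Finset.sum_congr rfl fun i _ => by rw [he.extend_apply]
  · intro v _ hv
    rw [Function.extend_apply' _ _ _ (by simpa using hv), Pi.zero_apply, hg]

namespace StraightTriangulation

variable [Fintype V] [DecidableEq V] {G : SimpleGraph V} (D : StraightTriangulation G)

theorem weight_single (v : V) : IsCellWeight D.facets (Pi.single v 1) := by
  obtain ⟨t, ht, hv⟩ := D.exists_vertex_mem v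
  refine ⟨fun x => ?_, t, ht, fun x hx => ?_⟩
  · by_cases h : x = v
    · subst h; simp
    · simp [h]
  · have : x ≠ v := fun h => hx (h ▸ hv)
    simp [this]

theorem sum_single_smul (v : V) : ∑ x, (Pi.single v 1 : V → ℝ) x • D.pos x = D.pos v := by
  simp [Pi.single_apply]

theorem exists_weight_of_mem_segment {a b : V} (h : G.Adj a b) {q : ℝ × ℝ}
    (hq : q ∈ segment ℝ (D.pos a) (D.pos b)) :
    ∃ w : V → ℝ, IsCellWeight D.facets w ∧ ∑ v, w v = 1 ∧ ∑ v, w v • D.pos v = q ∧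
      ∀ v, w v ≠ 0 → v = a ∨ v = b := by
  obtain ⟨r, s, hr, hs, hrs, rfl⟩ := hq
  obtain ⟨t, ht, hat, hbt⟩ := D.exists_edge_mem h
  refine ⟨fun v => (if v = a then r else 0) + (if v = b then s else 0),
    ⟨fun v => by positivity, t, ht, fun v hv => ?_⟩, ?_, ?_, fun v hv => ?_⟩
  · have h1 : v ≠ a := fun h => hv (h ▸ hat)
    have h2 : v ≠ b := fun h => hv (h ▸ hbt)
    simp [h1, h2]
  · simpa [Finset.sum_add_distrib] using hrs
  · simp [Finset.sum_add_distrib, add_smul, ite_smul]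
  · by_contra! hc
    simp [hc.1, hc.2] at hv

theorem pos_injective : Function.Injective D.pos := by
  intro a b hab
  have := D.weight_unique _ _ (D.weight_single a) (D.weight_single b) (by simp)
    (by rw [D.sum_single_smul, D.sum_single_smul, hab])
  have h1 := congrFun this a
  by_contra hne
  simp [hne] at h1

/-- The plane embedding in which every edge is a straight line segment. -/
noncomputable def toPlaneEmbedding : PlaneEmbedding G where
  vertexMap := D.pos
  vertex_inj := D.pos_injective
  edgeMap a b _ :=
    { toFun := fun s => AffineMap.lineMap (D.pos a) (D.pos b) (s : ℝ)
      continuous_toFun := AffineMap.lineMap_continuous.comp continuous_subtype_val }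
  edge_start a b h := by simp
  edge_end a b h := by simp
  edge_inj a b h :=
    (AffineMap.lineMap_injective ℝ (D.pos_injective.ne h.ne)).comp Subtype.val_injective
  edge_symm a b h := by
    exact (range_lineMap_unitInterval _ _).trans
      ((segment_symm ℝ _ _).trans (range_lineMap_unitInterval _ _).symm)
  edge_int a b c d h h' hne := by
    rintro q ⟨hq, hq'⟩
    obtain ⟨w, hw, hw1, hwq, hwab⟩ := D.exists_weight_of_mem_segment h
      ((range_lineMap_unitInterval _ _).subset hq)
    obtain ⟨w', hw', hw1', hwq', hwcd⟩ := D.exists_weight_of_mem_segment h'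
      ((range_lineMap_unitInterval _ _).subset hq')
    obtain rfl := D.weight_unique w w' hw hw' (hw1.trans hw1'.symm) (hwq.trans hwq'.symm)
    obtain ⟨v, hv⟩ : ∃ v, w v ≠ 0 := by
      by_contra! hc
      simp [hc] at hw1
    have hv0 : ∀ x, x ≠ v → w x = 0 := by
      intro x hx
      by_contra hx0
      refine hne ?_
      have h1 := hwab v hv
      have h2 := hwcd v hv
      have h3 := hwab x hx0
      have h4 := hwcd x hx0
      grind
    refine ⟨v, ⟨hwab v hv, hwcd v hv⟩, ?_⟩
    rw [Fintype.sum_eq_single v hv0] at hw1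
    rw [Fintype.sum_eq_single v fun x hx => by rw [hv0 x hx, zero_smul], hw1, one_smul] at hwq
    exact hwq
  edge_no_vertex a b h x hx := by
    obtain ⟨w, hw, hw1, hwq, hwab⟩ := D.exists_weight_of_mem_segment h
      ((range_lineMap_unitInterval _ _).subset hx)
    obtain rfl := D.weight_unique w _ hw (D.weight_single x) (by rw [hw1]; simp)
      (by rw [hwq, D.sum_single_smul])
    exact hwab x (by simp)

theorem range_edgeMap {a b : V} (h : G.Adj a b) :
    Set.range (D.toPlaneEmbedding.edgeMap h) = segment ℝ (D.pos a) (D.pos b) :=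
  range_lineMap_unitInterval _ _

theorem segment_subset_drawing {a b : V} (h : G.Adj a b) :
    segment ℝ (D.pos a) (D.pos b) ⊆ D.toPlaneEmbedding.drawing := by
  rw [← D.range_edgeMap h]
  refine Set.subset_union_of_subset_right ?_ _
  exact Set.subset_iUnion_of_subset a (Set.subset_iUnion_of_subset b
    (Set.subset_iUnion_of_subset h subset_rfl))

theorem mem_drawing {q : ℝ × ℝ} (hq : q ∈ D.toPlaneEmbedding.drawing) :
    (∃ v, q = D.pos v) ∨ ∃ a b, G.Adj a b ∧ q ∈ segment ℝ (D.pos a) (D.pos b) := by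
  rcases hq with ⟨v, rfl⟩ | hq
  · exact Or.inl ⟨v, rfl⟩
  · simp only [Set.mem_iUnion] at hq
    obtain ⟨a, b, h, hq⟩ := hq
    exact Or.inr ⟨a, b, h, (D.range_edgeMap h).subset hq⟩

theorem exists_weight_of_mem_drawing {q : ℝ × ℝ} (hq : q ∈ D.toPlaneEmbedding.drawing) :
    ∃ w : V → ℝ, IsCellWeight D.facets w ∧ ∑ v, w v = 1 ∧ ∑ v, w v • D.pos v = q ∧
      ∃ a b, ∀ v, w v ≠ 0 → v = a ∨ v = b := by
  rcases D.mem_drawing hq with ⟨v, rfl⟩ | ⟨a, b, h, hq⟩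
  · refine ⟨_, D.weight_single v, by simp, D.sum_single_smul v, v, v, fun x hx => ?_⟩
    by_contra hc
    simp only [or_self] at hc
    simp [hc] at hx
  · obtain ⟨w, h1, h2, h3, h4⟩ := D.exists_weight_of_mem_segment h hq
    exact ⟨w, h1, h2, h3, a, b, h4⟩

theorem drawing_subset_baseTriangle : D.toPlaneEmbedding.drawing ⊆ baseTriangle := by
  intro q hq
  rcases D.mem_drawing hq with ⟨v, rfl⟩ | ⟨a, b, -, hq⟩
  · exact D.pos_mem v
  · exact convex_baseTriangle.segment_subset (D.pos_mem a) (D.pos_mem b) hq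

theorem isCellWeight_extend {t : Finset V} (ht : t ∈ D.facets) {e : Fin 3 → V}
    (he : Function.Injective e) (het : ∀ i, e i ∈ t) {c : Fin 3 → ℝ} (hc : ∀ i, 0 ≤ c i) :
    IsCellWeight D.facets (Function.extend e c 0) := by
  refine ⟨fun v => ?_, t, ht, fun v hv => ?_⟩
  · by_cases hv : ∃ i, e i = v
    · obtain ⟨i, rfl⟩ := hv
      rw [he.extend_apply]
      exact hc i
    · rw [Function.extend_apply' _ _ _ hv]
      rfl
  · rw [Function.extend_apply' _ _ _ (by rintro ⟨i, rfl⟩; exact hv (het i))]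
    rfl

theorem affineIndependent_facet {t : Finset V} (ht : t ∈ D.facets) {e : Fin 3 → V}
    (he : Function.Injective e) (het : ∀ i, e i ∈ t) :
    AffineIndependent ℝ (fun i => D.pos (e i)) := by
  rw [affineIndependent_iff_of_fintype]
  intro c hc h i
  rw [Finset.weightedVSub_eq_linear_combination _ hc] at h
  have hsub : ∀ j, c j = (c j)⁺ - (c j)⁻ := fun j => (posPart_sub_negPart (c j)).symm
  have := D.weight_unique _ _ (D.isCellWeight_extend ht he het fun j => posPart_nonneg (c j))
    (D.isCellWeight_extend ht he het fun j => negPart_nonneg (c j)) ?_ ?_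
  · have := congrFun this (e i)
    rw [he.extend_apply, he.extend_apply] at this
    rw [hsub i, this, sub_self]
  · rw [sum_extend he _ (fun _ x => x) (fun _ => rfl), sum_extend he _ (fun _ x => x)
      (fun _ => rfl), ← sub_eq_zero, ← Finset.sum_sub_distrib, ← hc]
    exact Finset.sum_congr rfl fun j _ => (hsub j).symm
  · rw [sum_extend he _ (fun v x => x • D.pos v) (fun _ => zero_smul _ _),
      sum_extend he _ (fun v x => x • D.pos v) (fun _ => zero_smul _ _), ← sub_eq_zero,
      ← Finset.sum_sub_distrib, ← h]
    exact Finset.sum_congr rfl fun j _ => by rw [← sub_smul, ← hsub j]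

theorem isFace_faceIsTriangle {F : Set (ℝ × ℝ)} (hF : D.toPlaneEmbedding.IsFace F) :
    D.toPlaneEmbedding.FaceIsTriangle F := by
  obtain ⟨x, hx, rfl⟩ := hF
  /- An open connected region avoiding the drawing and bounded by three edges is a face. -/
  have key : ∀ (e : Fin 3 → V) (U : Set (ℝ × ℝ)), (∀ i j, i ≠ j → G.Adj (e i) (e j)) →
      IsPreconnected U → IsOpen U → U ⊆ D.toPlaneEmbedding.drawingᶜ → x ∈ U →
      frontier U = segment ℝ (D.pos (e 0)) (D.pos (e 1)) ∪
        segment ℝ (D.pos (e 1)) (D.pos (e 2)) ∪ segment ℝ (D.pos (e 2)) (D.pos (e 0)) →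
      D.toPlaneEmbedding.FaceIsTriangle
        (connectedComponentIn D.toPlaneEmbedding.drawingᶜ x) := by
    intro e U hadj hU ho hsub hxU hfr
    have h01 := hadj 0 1 (by decide)
    have h12 := hadj 1 2 (by decide)
    have h20 := hadj 2 0 (by decide)
    refine ⟨e 0, e 1, e 2, h01, h12, h20, ?_⟩
    rw [connectedComponentIn_eq_of_disjoint_frontier hU ho hsub ?_ hxU, D.range_edgeMap,
      D.range_edgeMap, D.range_edgeMap, hfr]
    rw [hfr, Set.disjoint_compl_right_iff_subset]
    exact Set.union_subset (Set.union_subset (D.segment_subset_drawing h01)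
      (D.segment_subset_drawing h12)) (D.segment_subset_drawing h20)
  by_cases hxB : x ∈ baseTriangle
  · obtain ⟨w, ⟨hw0, t, ht, hwt⟩, hw1, hwx⟩ := D.exists_weight x hxB
    have hcl := D.isNClique t ht
    let e' : Fin 3 ≃ t := (t.equivFinOfCardEq hcl.card_eq).symm
    let e : Fin 3 → V := fun i => e' i
    have he : Function.Injective e := Subtype.val_injective.comp e'.injective
    have het : ∀ i, e i ∈ t := fun i => (e' i).2
    have hadj : ∀ i j, i ≠ j → G.Adj (e i) (e j) := fun i j hij =>
      hcl.isClique (het i) (het j) (he.ne hij)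
    let b := (D.affineIndependent_facet ht he het).planeBasis
    have hb : ∀ i, b i = D.pos (e i) := fun i => rfl
    have hfr := b.frontier_convexHull_fin_three
    simp only [hb] at hfr
    have hxH : x ∈ convexHull ℝ (range b) := by
      rw [← hwx, ← Finset.sum_subset (Finset.subset_univ t) fun v _ hv => by
        rw [hwt v hv, zero_smul]]
      refine (convex_convexHull ℝ _).sum_mem (fun v _ => hw0 v) ?_ fun v hv => ?_
      · rw [← hw1]
        exact Finset.sum_subset (Finset.subset_univ t) fun v _ hv => hwt v hv
      · refine subset_convexHull ℝ _ ⟨e'.symm ⟨v, hv⟩, ?_⟩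
        simp [hb, e]
    have hxU : x ∈ interior (convexHull ℝ (range b)) := by
      by_contra hc
      refine hx ?_
      have : x ∈ frontier (convexHull ℝ (range b)) := ⟨subset_closure hxH, hc⟩
      rw [hfr] at this
      rcases this with (h | h) | h
      · exact D.segment_subset_drawing (hadj 0 1 (by decide)) h
      · exact D.segment_subset_drawing (hadj 1 2 (by decide)) h
      · exact D.segment_subset_drawing (hadj 2 0 (by decide)) h
    refine key e (interior (convexHull ℝ (range b))) hadj
      (convex_convexHull ℝ _).interior.isPreconnected isOpen_interior ?_ hxU ?_
    · intro y hy hyD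
      rw [b.interior_convexHull] at hy
      obtain ⟨w', hw', hw1', hwy', a, c, hac⟩ := D.exists_weight_of_mem_drawing hyD
      have := D.weight_unique _ _ hw'
        (D.isCellWeight_extend ht he het fun i => (hy i).le) ?_ ?_
      · have hmem : ∀ i, e i = a ∨ e i = c := fun i => hac _ (by
          rw [this, he.extend_apply]
          exact (hy i).ne')
        have h01 : e 0 ≠ e 1 := he.ne (by decide)
        have h02 : e 0 ≠ e 2 := he.ne (by decide)
        have h12 : e 1 ≠ e 2 := he.ne (by decide)
        have h0 := hmem 0
        have h1 := hmem 1
        have h2 := hmem 2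
        grind
      · rw [sum_extend he _ (fun _ x => x) (fun _ => rfl), hw1', b.sum_coord_apply_eq_one]
      · rw [sum_extend he _ (fun v x => x • D.pos v) (fun _ => zero_smul _ _), hwy']
        exact (b.linear_combination_coord_eq_self y).symm
    · rw [(convex_convexHull ℝ _).frontier_interior_eq ⟨x, hxU⟩, hfr]
  · refine key D.corner baseTriangleᶜ D.corner_adj isPreconnected_compl_baseTriangle
      isClosed_baseTriangle.isOpen_compl
      (Set.compl_subset_compl.2 D.drawing_subset_baseTriangle) hxB ?_
    rw [frontier_compl, baseTriangle_eq_convexHull]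
    simpa [D.pos_corner] using
      affineIndependent_baseTriangle.planeBasis.frontier_convexHull_fin_three

end StraightTriangulation

namespace StraightTriangulation

section Stack

theorem exists_mem_ne_ne {t : Finset V} (ht : t.card = 3) (a b : V) :
    ∃ i ∈ t, a ≠ i ∧ b ≠ i := by
  classical
  obtain ⟨i, hi, hi'⟩ := Finset.exists_mem_notMem_of_card_lt_card
    (s := {a, b}) (t := t) (by rw [ht]; exact Finset.card_le_two.trans_lt (by norm_num))
  simp only [Finset.mem_insert, Finset.mem_singleton, not_or] at hi'
  exact ⟨i, hi, Ne.symm hi'.1, Ne.symm hi'.2⟩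

variable [DecidableEq V] {T : Set (Finset V)} {t : Finset V}

/-- The facets after subdividing the facet `t` by a new vertex. -/
def stackFacets (T : Set (Finset V)) (t : Finset V) : Set (Finset (Option V)) :=
  {s | ∃ u ∈ T, u ≠ t ∧ s = u.map Function.Embedding.some} ∪
    {s | ∃ i ∈ t, s = Finset.insertNone (t.erase i)}

/-- Distribute the weight of the new vertex evenly to the vertices of the subdivided facet. -/
noncomputable def pushWeight (t : Finset V) (w : Option V → ℝ) (v : V) : ℝ :=
  w (some v) + if v ∈ t then w none / 3 else 0

theorem isCellWeight_pushWeight (ht : t ∈ T) {w : Option V → ℝ}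
    (hw : IsCellWeight (stackFacets T t) w) : IsCellWeight T (pushWeight t w) := by
  obtain ⟨h0, s, hs, hws⟩ := hw
  refine ⟨fun v => ?_, ?_⟩
  · have h1 := h0 (some v)
    have h2 := h0 none
    unfold pushWeight
    positivity
  · rcases hs with ⟨u, hu, -, rfl⟩ | ⟨i, -, rfl⟩
    · refine ⟨u, hu, fun v hv => ?_⟩
      simp [pushWeight, hws none (by simp), hws (some v) (by simpa using hv)]
    · refine ⟨t, ht, fun v hv => ?_⟩
      simp [pushWeight, hv, hws (some v) (by simp [hv])]

theorem sum_pushWeight [Fintype V] (ht : t.card = 3) (w : Option V → ℝ) :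
    ∑ v, pushWeight t w v = ∑ o, w o := by
  simp only [pushWeight, Finset.sum_add_distrib, Fintype.sum_option, Finset.sum_ite_mem,
    Finset.univ_inter, Finset.sum_const, ht, nsmul_eq_mul]
  push_cast
  ring

/-- The vertex positions after placing a new vertex at the centroid of `t`. -/
noncomputable def stackPos (pos : V → ℝ × ℝ) (t : Finset V) (o : Option V) : ℝ × ℝ :=
  o.elim ((1 / 3 : ℝ) • ∑ v ∈ t, pos v) pos

theorem sum_pushWeight_smul [Fintype V] (pos : V → ℝ × ℝ) (t : Finset V) (w : Option V → ℝ) :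
    ∑ v, pushWeight t w v • pos v = ∑ o, w o • stackPos pos t o := by
  simp only [pushWeight, add_smul, Finset.sum_add_distrib, Fintype.sum_option, ite_smul, zero_smul,
    Finset.sum_ite_mem, Finset.univ_inter, stackPos, Option.elim, smul_smul, ← Finset.smul_sum]
  rw [add_comm]
  congr 2
  ring

theorem pushWeight_injective_of_isCellWeight (hT : ∀ u ∈ T, u.card = t.card)
    {w₁ w₂ : Option V → ℝ} (h₁ : IsCellWeight (stackFacets T t) w₁)
    (h₂ : IsCellWeight (stackFacets T t) w₂) (h : pushWeight t w₁ = pushWeight t w₂) :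
    w₁ = w₂ := by
  have key : ∀ {w w' : Option V → ℝ}, IsCellWeight (stackFacets T t) w →
      IsCellWeight (stackFacets T t) w' → pushWeight t w = pushWeight t w' →
      w none ≤ w' none := by
    intro w w' hw hw' h
    by_contra! hlt
    obtain ⟨h0, -⟩ := hw
    obtain ⟨-, s, hs, hws⟩ := hw'
    have hts : ∀ v ∈ t, some v ∈ s := by
      intro v hv
      by_contra hvs
      have hv' := congrFun h v
      simp only [pushWeight, hv, if_true, hws _ hvs] at hv'
      have := h0 (some v)
      linarith
    rcases hs with ⟨u, hu, hut, rfl⟩ | ⟨i, hi, rfl⟩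
    · refine hut (Finset.eq_of_subset_of_card_le (fun v hv => ?_) (hT u hu).le).symm
      simpa using hts v hv
    · simpa using hts i hi
  have hn : w₁ none = w₂ none := le_antisymm (key h₁ h₂ h) (key h₂ h₁ h.symm)
  funext o
  rcases o with _ | v
  · exact hn
  · have := congrFun h v
    simpa [pushWeight, hn] using this

theorem exists_isCellWeight_pushWeight_eq (ht : t.Nonempty) {w : V → ℝ}
    (hw : IsCellWeight T w) : ∃ w', IsCellWeight (stackFacets T t) w' ∧ pushWeight t w' = w := by
  obtain ⟨h0, s, hs, hws⟩ := hw
  by_cases hst : s = t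
  · subst hst
    obtain ⟨i, hi, hmin⟩ := s.exists_min_image w ht
    refine ⟨fun o => o.elim (3 * w i) fun v => if v ∈ s then w v - w i else 0,
      ⟨?_, _, Or.inr ⟨i, hi, rfl⟩, ?_⟩, ?_⟩
    · rintro (_ | v)
      · simpa using h0 i
      · by_cases hv : v ∈ s
        · simpa [hv] using hmin v hv
        · simp [hv]
    · rintro (_ | v) hv
      · simp at hv
      · by_cases hvs : v ∈ s
        · have : v = i := by simpa [hvs] using hv
          simp [this]
        · simp [hvs]
    · funext v
      by_cases hvs : v ∈ s
      · simp [pushWeight, hvs]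
      · simp [pushWeight, hvs, hws v hvs]
  · refine ⟨fun o => o.elim 0 w, ⟨?_, _, Or.inl ⟨s, hs, hst, rfl⟩, ?_⟩, ?_⟩
    · rintro (_ | v)
      · exact le_rfl
      · exact h0 v
    · rintro (_ | v) hv
      · rfl
      · exact hws v (by simpa using hv)
    · funext v
      simp [pushWeight]

theorem exists_mem_stackFacets (hT : t.card = 3) {a b : V}
    (h : ∃ u ∈ T, a ∈ u ∧ b ∈ u) : ∃ s ∈ stackFacets T t, some a ∈ s ∧ some b ∈ s := by
  obtain ⟨u, hu, ha, hb⟩ := h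
  by_cases hut : u = t
  · subst hut
    obtain ⟨i, hi, hai, hbi⟩ := exists_mem_ne_ne hT a b
    exact ⟨_, Or.inr ⟨i, hi, rfl⟩, by simp [ha, hai], by simp [hb, hbi]⟩
  · exact ⟨_, Or.inl ⟨u, hu, hut, rfl⟩, by simpa using ha, by simpa using hb⟩

theorem exists_none_mem_stackFacets (hT : t.card = 3) {a : V} (ha : a ∈ t) :
    ∃ s ∈ stackFacets T t, none ∈ s ∧ some a ∈ s := by
  obtain ⟨i, hi, hai, -⟩ := exists_mem_ne_ne hT a a
  exact ⟨_, Or.inr ⟨i, hi, rfl⟩, by simp, by simp [ha, hai]⟩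

theorem isNClique_of_mem_stackFacets {G : SimpleGraph V} (hT : ∀ u ∈ T, G.IsNClique 3 u)
    (ht : t ∈ T) {s : Finset (Option V)} (hs : s ∈ stackFacets T t) :
    (stackGraph G t).IsNClique 3 s := by
  rw [isNClique_iff, isClique_iff, Set.Pairwise]
  rcases hs with ⟨u, hu, -, rfl⟩ | ⟨i, hi, rfl⟩
  · refine ⟨?_, by rw [Finset.card_map, (hT u hu).card_eq]⟩
    rintro (_ | x) hx (_ | y) hy hxy
    · exact absurd rfl hxy
    · simp at hx
    · simp at hy
    · exact (hT u hu).isClique (by simpa using hx) (by simpa using hy) (by simpa using hxy)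
  · refine ⟨?_, by
      rw [Finset.card_insertNone, Finset.card_erase_of_mem hi, (hT t ht).card_eq]⟩
    rintro (_ | x) hx (_ | y) hy hxy
    · exact absurd rfl hxy
    · exact Finset.mem_of_mem_erase (by simpa using hy)
    · exact Finset.mem_of_mem_erase (by simpa using hx)
    · exact (hT t ht).isClique (Finset.mem_of_mem_erase (by simpa using hx))
        (Finset.mem_of_mem_erase (by simpa using hy)) (by simpa using hxy)

/-- Subdivide the facet `t` by a new vertex at its centroid. -/
noncomputable def stack [Fintype V] {G : SimpleGraph V} (D : StraightTriangulation G)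
    (t : Finset V) (ht : t ∈ D.facets) : StraightTriangulation (stackGraph G t) where
  pos := stackPos D.pos t
  facets := stackFacets D.facets t
  isNClique _ hs := isNClique_of_mem_stackFacets D.isNClique ht hs
  exists_vertex_mem o := by
    have hcard := (D.isNClique t ht).card_eq
    rcases o with _ | v
    · obtain ⟨a, ha⟩ := Finset.card_pos.1 (by omega : 0 < t.card)
      obtain ⟨s, hs, h, -⟩ := exists_none_mem_stackFacets hcard ha
      exact ⟨s, hs, h⟩
    · obtain ⟨u, hu, hv⟩ := D.exists_vertex_mem v
      obtain ⟨s, hs, h, -⟩ := exists_mem_stackFacets hcard ⟨u, hu, hv, hv⟩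
      exact ⟨s, hs, h⟩
  exists_edge_mem := by
    have hcard := (D.isNClique t ht).card_eq
    rintro (_ | a) (_ | b) h
    · exact absurd h stackGraph_none_none
    · exact exists_none_mem_stackFacets hcard h
    · obtain ⟨s, hs, h1, h2⟩ := exists_none_mem_stackFacets (T := D.facets) hcard h
      exact ⟨s, hs, h2, h1⟩
    · exact exists_mem_stackFacets hcard (D.exists_edge_mem h)
  weight_unique w₁ w₂ h₁ h₂ hsum hpos := by
    have hcard := (D.isNClique t ht).card_eq
    refine pushWeight_injective_of_isCellWeight
      (fun u hu => (D.isNClique u hu).card_eq.trans hcard.symm) h₁ h₂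
      (D.weight_unique _ _ (isCellWeight_pushWeight ht h₁) (isCellWeight_pushWeight ht h₂) ?_ ?_)
    · rw [sum_pushWeight hcard, sum_pushWeight hcard, hsum]
    · rw [sum_pushWeight_smul, sum_pushWeight_smul, hpos]
  pos_mem := by
    rintro (_ | v)
    · rw [stackPos, Option.elim, Finset.smul_sum]
      refine convex_baseTriangle.sum_mem (fun _ _ => by norm_num) ?_ fun v _ => D.pos_mem v
      simp [(D.isNClique t ht).card_eq]
    · exact D.pos_mem v
  exists_weight q hq := by
    have hcard := (D.isNClique t ht).card_eq
    obtain ⟨w, hw, hw1, hwq⟩ := D.exists_weight q hq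
    obtain ⟨w', hw', rfl⟩ := exists_isCellWeight_pushWeight_eq
      (Finset.card_pos.1 (by omega : 0 < t.card)) hw
    exact ⟨w', hw', by rw [← sum_pushWeight hcard, hw1], by rw [← sum_pushWeight_smul, hwq]⟩
  corner i := some (D.corner i)
  pos_corner := D.pos_corner
  corner_adj := D.corner_adj

end Stack

end StraightTriangulation

section Octahedron

/-- The octahedron: two vertices are adjacent unless they are equal or antipodal. -/
def octahedron : SimpleGraph (Fin 3 × Bool) where
  Adj u v := u.1 ≠ v.1
  symm := ⟨fun _ _ h => h.symm⟩
  loopless := ⟨fun _ h => h rfl⟩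

theorem inseparableOn_octahedron {S : Set (Fin 3 × Bool)} (hS : S.ncard ≤ 3) :
    InseparableOn octahedron Sᶜ := by
  intro P hP x hx y hy
  by_cases hxy : x.1 = y.1
  · obtain ⟨z, hz, hzS⟩ : ∃ z ∈ Finset.univ.filter (fun z : Fin 3 × Bool => z.1 ≠ x.1), z ∉ S := by
      by_contra! hc
      have h4 : ∀ i : Fin 3, (Finset.univ.filter (fun z : Fin 3 × Bool => z.1 ≠ i)).card = 4 := by
        decide
      have := Set.ncard_le_ncard (s := (Finset.univ.filter
        (fun z : Fin 3 × Bool => z.1 ≠ x.1) : Finset _)) (t := S)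
        (fun z hz => hc z hz) S.toFinite
      rw [Set.ncard_coe_finset, h4] at this
      omega
    replace hz : z.1 ≠ x.1 := by simpa using hz
    exact (hP x hx z hzS hz.symm).trans (hP z hzS y hy (show z.1 ≠ y.1 from hxy ▸ hz))
  · exact hP x hx y hy hxy

theorem isKConnected_octahedron : IsKConnected 3 octahedron :=
  (isKConnected_iff_inseparableOn _).2
    ⟨by simp, fun _ hS => inseparableOn_octahedron hS.le⟩

theorem not_isThreeCut_octahedron (S : Set (Fin 3 × Bool)) : ¬ IsThreeCut octahedron S := by
  rw [isThreeCut_iff_inseparableOn]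
  rintro ⟨h, hc⟩
  exact hc (inseparableOn_octahedron h.le)

/-- The face of the octahedron that is covered by the apex of `cappedOctahedron`. -/
def octahedronFace : Finset (Fin 3 × Bool) := {(0, true), (1, true), (2, true)}

theorem isNClique_octahedronFace : octahedron.IsNClique 3 octahedronFace := by
  rw [octahedronFace, is3Clique_triple_iff]
  simp [octahedron]

/-- The octahedron with an additional vertex stacked onto one face. -/
abbrev cappedOctahedron : SimpleGraph (Option (Fin 3 × Bool)) :=
  stackGraph octahedron octahedronFace

/-- A triangular face of the octahedron, with one vertex from each antipodal pair. -/
def octFacet (p q r : Bool) : Finset (Option (Fin 3 × Bool)) :=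
  {some (0, p), some (1, q), some (2, r)}

/-- The bounded faces of the straight-line drawing of `cappedOctahedron`. -/
def cappedFacets : Set (Finset (Option (Fin 3 × Bool))) :=
  {s | (∃ p q r, (p && q && r) = false ∧ s = octFacet p q r) ∨
    s = {none, some (0, true), some (2, true)} ∨ s = {none, some (1, true), some (2, true)}}

/-- The vertex positions of the straight-line drawing of `cappedOctahedron`. -/
noncomputable def cappedPos : Option (Fin 3 × Bool) → ℝ × ℝ
  | none => (0, 1)
  | some (0, true) => (0, 0)
  | some (1, true) => (1, 0)
  | some (2, true) => (1 / 3, 1 / 3)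
  | some (0, false) => (8 / 15, 2 / 15)
  | some (1, false) => (1 / 3, 2 / 15)
  | some (2, false) => (7 / 15, 1 / 15)

theorem zero_pattern_of_isCellWeight {w : Option (Fin 3 × Bool) → ℝ}
    (hw : IsCellWeight cappedFacets w) :
    (w none = 0 ∧ ((w (some (0, true)) = 0 ∧ w (some (1, true)) = 0 ∧ w (some (2, true)) = 0) ∨
      (w (some (0, true)) = 0 ∧ w (some (1, true)) = 0 ∧ w (some (2, false)) = 0) ∨
      (w (some (0, true)) = 0 ∧ w (some (1, false)) = 0 ∧ w (some (2, true)) = 0) ∨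
      (w (some (0, true)) = 0 ∧ w (some (1, false)) = 0 ∧ w (some (2, false)) = 0) ∨
      (w (some (0, false)) = 0 ∧ w (some (1, true)) = 0 ∧ w (some (2, true)) = 0) ∨
      (w (some (0, false)) = 0 ∧ w (some (1, true)) = 0 ∧ w (some (2, false)) = 0) ∨
      (w (some (0, false)) = 0 ∧ w (some (1, false)) = 0 ∧ w (some (2, true)) = 0))) ∨
    ((w (some (0, false)) = 0 ∧ w (some (1, false)) = 0 ∧ w (some (2, false)) = 0) ∧
      (w (some (1, true)) = 0 ∨ w (some (0, true)) = 0)) := by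
  obtain ⟨-, s, ⟨p, q, r, hpqr, rfl⟩ | rfl | rfl, hs⟩ := hw
  · have h0 := hs none (by simp [octFacet])
    have h1 := hs (some (0, !p)) (by simp [octFacet])
    have h2 := hs (some (1, !q)) (by simp [octFacet])
    have h3 := hs (some (2, !r)) (by simp [octFacet])
    cases p <;> cases q <;> cases r <;> simp_all
  · simp [hs]
  · simp [hs]

set_option maxHeartbeats 1000000 in
theorem capped_outer_weight_le {w₁ w₂ : Option (Fin 3 × Bool) → ℝ}
    (h₁ : IsCellWeight cappedFacets w₁) (h₂ : IsCellWeight cappedFacets w₂)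
    (hsum : ∑ v, w₁ v = ∑ v, w₂ v)
    (hpos : ∑ v, w₁ v • cappedPos v = ∑ v, w₂ v • cappedPos v) :
    w₁ none ≤ w₂ none ∧ ∀ i, w₁ (some (i, true)) ≤ w₂ (some (i, true)) := by
  have z₁ := zero_pattern_of_isCellWeight h₁
  have z₂ := zero_pattern_of_isCellWeight h₂
  obtain ⟨n₁, -⟩ := h₁
  obtain ⟨n₂, -⟩ := h₂
  simp only [Fintype.sum_option, Fintype.sum_prod_type, Fin.sum_univ_three, Fintype.sum_bool,
    cappedPos, Prod.smul_mk, smul_eq_mul, Prod.mk_add_mk, Prod.mk.injEq, mul_zero, mul_one,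
    zero_add] at hsum hpos
  simp only [Option.forall, Prod.forall, Fin.forall_fin_succ, Bool.forall_bool, Fin.isValue,
    Fin.succ_zero_eq_one, Fin.succ_one_eq_two, IsEmpty.forall_iff, and_true] at n₁ n₂ ⊢
  obtain ⟨a1, ⟨a2, a3⟩, ⟨a4, a5⟩, a6, a7⟩ := n₁
  obtain ⟨b1, ⟨b2, b3⟩, ⟨b4, b5⟩, b6, b7⟩ := n₂
  obtain ⟨hx, hy⟩ := hpos
  generalize w₁ none = v at *
  generalize w₁ (some (0, true)) = a at *
  generalize w₁ (some (1, true)) = b at *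
  generalize w₁ (some (2, true)) = c at *
  generalize w₁ (some (0, false)) = x at *
  generalize w₁ (some (1, false)) = y at *
  generalize w₁ (some (2, false)) = z at *
  generalize w₂ none = v' at *
  generalize w₂ (some (0, true)) = a' at *
  generalize w₂ (some (1, true)) = b' at *
  generalize w₂ (some (2, true)) = c' at *
  generalize w₂ (some (0, false)) = x' at *
  generalize w₂ (some (1, false)) = y' at *
  generalize w₂ (some (2, false)) = z' at *
  rcases z₁ with ⟨rfl, ⟨rfl, rfl, rfl⟩ | ⟨rfl, rfl, rfl⟩ | ⟨rfl, rfl, rfl⟩ | ⟨rfl, rfl, rfl⟩ |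
    ⟨rfl, rfl, rfl⟩ | ⟨rfl, rfl, rfl⟩ | ⟨rfl, rfl, rfl⟩⟩ | ⟨⟨rfl, rfl, rfl⟩, rfl | rfl⟩ <;>
  refine ⟨?_, ?_, ?_, ?_⟩ <;> try assumption
  all_goals
    rcases z₂ with ⟨rfl, ⟨rfl, rfl, rfl⟩ | ⟨rfl, rfl, rfl⟩ | ⟨rfl, rfl, rfl⟩ | ⟨rfl, rfl, rfl⟩ |
      ⟨rfl, rfl, rfl⟩ | ⟨rfl, rfl, rfl⟩ | ⟨rfl, rfl, rfl⟩⟩ | ⟨⟨rfl, rfl, rfl⟩, rfl | rfl⟩ <;>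
    linarith

theorem capped_weight_unique (w₁ w₂ : Option (Fin 3 × Bool) → ℝ)
    (h₁ : IsCellWeight cappedFacets w₁) (h₂ : IsCellWeight cappedFacets w₂)
    (hsum : ∑ v, w₁ v = ∑ v, w₂ v)
    (hpos : ∑ v, w₁ v • cappedPos v = ∑ v, w₂ v • cappedPos v) : w₁ = w₂ := by
  obtain ⟨hn, ht⟩ := capped_outer_weight_le h₁ h₂ hsum hpos
  obtain ⟨hn', ht'⟩ := capped_outer_weight_le h₂ h₁ hsum.symm hpos.symm
  replace hn := hn.antisymm hn'
  replace ht := fun i => (ht i).antisymm (ht' i)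
  simp only [Fintype.sum_option, Fintype.sum_prod_type, Fin.sum_univ_three, Fintype.sum_bool,
    cappedPos, Prod.smul_mk, smul_eq_mul, Prod.mk_add_mk, Prod.mk.injEq, mul_zero, mul_one,
    zero_add, hn, ht] at hsum hpos
  obtain ⟨hx, hy⟩ := hpos
  have k1 : w₁ (some (0, false)) = w₂ (some (0, false)) := by linarith
  have k2 : w₁ (some (1, false)) = w₂ (some (1, false)) := by linarith
  have k3 : w₁ (some (2, false)) = w₂ (some (2, false)) := by linarith
  funext o
  rcases o with _ | ⟨i, _ | _⟩
  · exact hn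
  · fin_cases i <;> assumption
  · exact ht i

theorem capped_weight_of_facet {i j k : Option (Fin 3 × Bool)}
    (h : ({i, j, k} : Finset _) ∈ cappedFacets) {α β γ : ℝ} {q : ℝ × ℝ} (hα : 0 ≤ α)
    (hβ : 0 ≤ β) (hγ : 0 ≤ γ) (hsum : α + β + γ = 1)
    (h1 : α * (cappedPos i).1 + β * (cappedPos j).1 + γ * (cappedPos k).1 = q.1)
    (h2 : α * (cappedPos i).2 + β * (cappedPos j).2 + γ * (cappedPos k).2 = q.2) :
    ∃ w : Option (Fin 3 × Bool) → ℝ, IsCellWeight cappedFacets w ∧ ∑ v, w v = 1 ∧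
      ∑ v, w v • cappedPos v = q := by
  refine ⟨fun v => (if v = i then α else 0) + (if v = j then β else 0) + if v = k then γ else 0,
    ⟨fun v => by positivity, _, h, fun v hv => ?_⟩, ?_, ?_⟩
  · simp only [Finset.mem_insert, Finset.mem_singleton, not_or] at hv
    simp [hv.1, hv.2.1, hv.2.2]
  · simpa only [Finset.sum_add_distrib, Finset.sum_ite_eq', Finset.mem_univ, if_true] using hsum
  · simp only [Finset.sum_add_distrib, add_smul, ite_smul, zero_smul, Finset.sum_ite_eq',
      Finset.mem_univ, if_true]
    exact Prod.ext h1 h2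

/-- Every point of a triangle, given by barycentric coordinates, lies in one of the seven faces of
an octahedron drawn inside the triangle. -/
theorem octahedron_cover {s t u : ℝ} (h : s + t + u = 1) :
    (2 * u ≤ s ∧ 2 * u ≤ t) ∨ (2 * s ≤ t ∧ 2 * s ≤ u) ∨ (2 * t ≤ s ∧ 2 * t ≤ u) ∨
    (t ≤ 2 * u ∧ u ≤ 2 * t ∧ 2 / 5 ≤ s) ∨ (s ≤ 2 * u ∧ u ≤ 2 * s ∧ 2 / 5 ≤ t) ∨
    (s ≤ 2 * t ∧ t ≤ 2 * s ∧ 2 / 5 ≤ u) ∨ (s ≤ 2 / 5 ∧ t ≤ 2 / 5 ∧ u ≤ 2 / 5) := by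
  grind

theorem capped_exists_weight (q : ℝ × ℝ) (hq : q ∈ baseTriangle) :
    ∃ w : Option (Fin 3 × Bool) → ℝ, IsCellWeight cappedFacets w ∧ ∑ v, w v = 1 ∧
      ∑ v, w v • cappedPos v = q := by
  obtain ⟨X, Y⟩ := q
  obtain ⟨hX, hY, hXY⟩ := hq
  simp only at hX hY hXY
  have hoct : ∀ p q r, (p && q && r) = false →
      ({some (0, p), some (1, q), some (2, r)} : Finset (Option (Fin 3 × Bool))) ∈ cappedFacets :=
    fun p q r h => Or.inl ⟨p, q, r, h, rfl⟩
  by_cases habc : Y ≤ X ∧ X + 2 * Y ≤ 1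
  · obtain ⟨s, hs⟩ : ∃ s, s = 1 - X - 2 * Y := ⟨_, rfl⟩
    obtain ⟨t, ht⟩ : ∃ t, t = X - Y := ⟨_, rfl⟩
    obtain ⟨u, hu⟩ : ∃ u, u = 3 * Y := ⟨_, rfl⟩
    have hsum : s + t + u = 1 := by linarith
    rcases octahedron_cover hsum with h | h | h | h | h | h | h
    · refine capped_weight_of_facet (hoct true true false rfl) (α := s - 2 * u)
        (β := t - 2 * u) (γ := 5 * u) ?_ ?_ ?_ ?_ ?_ ?_ <;> (try simp only [cappedPos]) <;>
        linarith
    · refine capped_weight_of_facet (hoct false true true rfl) (α := 5 * s)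
        (β := t - 2 * s) (γ := u - 2 * s) ?_ ?_ ?_ ?_ ?_ ?_ <;> (try simp only [cappedPos]) <;>
        linarith
    · refine capped_weight_of_facet (hoct true false true rfl) (α := s - 2 * t)
        (β := 5 * t) (γ := u - 2 * t) ?_ ?_ ?_ ?_ ?_ ?_ <;> (try simp only [cappedPos]) <;>
        linarith
    · refine capped_weight_of_facet (hoct true false false rfl) (α := s - 2 / 3 * (t + u))
        (β := 5 / 3 * (2 * u - t)) (γ := 5 / 3 * (2 * t - u)) ?_ ?_ ?_ ?_ ?_ ?_ <;>
        (try simp only [cappedPos]) <;> linarith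
    · refine capped_weight_of_facet (hoct false true false rfl) (α := 5 / 3 * (2 * u - s))
        (β := t - 2 / 3 * (s + u)) (γ := 5 / 3 * (2 * s - u)) ?_ ?_ ?_ ?_ ?_ ?_ <;>
        (try simp only [cappedPos]) <;> linarith
    · refine capped_weight_of_facet (hoct false false true rfl) (α := 5 / 3 * (2 * t - s))
        (β := 5 / 3 * (2 * s - t)) (γ := u - 2 / 3 * (s + t)) ?_ ?_ ?_ ?_ ?_ ?_ <;>
        (try simp only [cappedPos]) <;> linarith
    · refine capped_weight_of_facet (hoct false false false rfl) (α := 2 - 5 * s)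
        (β := 2 - 5 * t) (γ := 2 - 5 * u) ?_ ?_ ?_ ?_ ?_ ?_ <;> (try simp only [cappedPos]) <;>
        linarith
  · by_cases hl : 2 * X + Y ≤ 1
    · have hYX : X ≤ Y := by
        by_contra! hc
        exact habc ⟨hc.le, by linarith⟩
      refine capped_weight_of_facet (Or.inr (Or.inl rfl)) (α := Y - X) (β := 1 - 2 * X - Y)
        (γ := 3 * X) ?_ ?_ ?_ ?_ ?_ ?_ <;> (try simp only [cappedPos]) <;>
        linarith
    · have hYX : 1 ≤ X + 2 * Y := by
        by_contra! hc
        exact habc ⟨by linarith, hc.le⟩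
      refine capped_weight_of_facet (Or.inr (Or.inr rfl)) (α := X + 2 * Y - 1)
        (β := 2 * X + Y - 1) (γ := 3 * (1 - X - Y)) ?_ ?_ ?_ ?_ ?_ ?_ <;>
        (try simp only [cappedPos]) <;> linarith

/-- The straight-line drawing of `cappedOctahedron`. -/
noncomputable def cappedTriangulation : StraightTriangulation cappedOctahedron where
  pos := cappedPos
  facets := cappedFacets
  isNClique := by
    rintro s (⟨p, q, r, -, rfl⟩ | rfl | rfl)
    · rw [octFacet, is3Clique_triple_iff]
      simp [octahedron]
    · rw [is3Clique_triple_iff]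
      simp [octahedron, octahedronFace]
    · rw [is3Clique_triple_iff]
      simp [octahedron, octahedronFace]
  exists_vertex_mem := by
    rintro (_ | ⟨i, p⟩)
    · exact ⟨_, Or.inr (Or.inl rfl), by simp⟩
    · fin_cases i
      · exact ⟨octFacet p false false, Or.inl ⟨_, _, _, by simp, rfl⟩, by simp [octFacet]⟩
      · exact ⟨octFacet false p false, Or.inl ⟨_, _, _, by simp, rfl⟩, by simp [octFacet]⟩
      · exact ⟨octFacet false false p, Or.inl ⟨_, _, _, by simp, rfl⟩, by simp [octFacet]⟩
  exists_edge_mem := by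
    have hn : ∀ x ∈ octahedronFace, ∃ t ∈ cappedFacets, none ∈ t ∧ some x ∈ t := by
      intro x hx
      simp only [octahedronFace, Finset.mem_insert, Finset.mem_singleton] at hx
      rcases hx with rfl | rfl | rfl
      · exact ⟨_, Or.inr (Or.inl rfl), by simp, by simp⟩
      · exact ⟨_, Or.inr (Or.inr rfl), by simp, by simp⟩
      · exact ⟨_, Or.inr (Or.inl rfl), by simp, by simp⟩
    rintro (_ | x) (_ | y) h
    · exact absurd h stackGraph_none_none
    · exact hn y h
    · obtain ⟨t, ht, h1, h2⟩ := hn x h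
      exact ⟨t, ht, h2, h1⟩
    · obtain ⟨i, p⟩ := x
      obtain ⟨j, q⟩ := y
      refine ⟨octFacet (if i = 0 then p else if j = 0 then q else false)
        (if i = 1 then p else if j = 1 then q else false)
        (if i = 2 then p else if j = 2 then q else false), Or.inl ⟨_, _, _, ?_, rfl⟩, ?_, ?_⟩
      all_goals
        replace h : i ≠ j := h
        fin_cases i <;> fin_cases j <;> simp_all [octFacet]
  weight_unique := capped_weight_unique
  pos_mem := by
    rintro (_ | ⟨i, p⟩)
    · norm_num [baseTriangle, cappedPos]
    · fin_cases i <;> cases p <;> norm_num [baseTriangle, cappedPos]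
  exists_weight := capped_exists_weight
  corner := ![some (0, true), some (1, true), none]
  pos_corner i := by fin_cases i <;> rfl
  corner_adj i j h := by
    fin_cases i <;> fin_cases j <;> simp_all [octahedron, octahedronFace]

theorem not_isThreeCut_of_mem_cappedFacets {s : Finset (Option (Fin 3 × Bool))}
    (hs : s ∈ cappedFacets) : ¬ IsThreeCut cappedOctahedron s := by
  rcases hs with ⟨p, q, r, h, rfl⟩ | rfl | rfl
  · have himg : (octFacet p q r : Set (Option (Fin 3 × Bool))) =
        some '' ({(0, p), (1, q), (2, r)} : Set (Fin 3 × Bool)) := by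
      simp [octFacet, Set.image_insert_eq]
    rw [himg, isThreeCut_stackGraph_image isNClique_octahedronFace]
    · exact not_isThreeCut_octahedron _
    · intro heq
      have h0 := heq.subset (by simp : ((0 : Fin 3), p) ∈ _)
      have h1 := heq.subset (by simp : ((1 : Fin 3), q) ∈ _)
      have h2 := heq.subset (by simp : ((2 : Fin 3), r) ∈ _)
      simp [octahedronFace] at h0 h1 h2
      simp [h0, h1, h2] at h
  · exact not_isThreeCut_stackGraph_of_none_mem isKConnected_octahedron (by simp)
  · exact not_isThreeCut_stackGraph_of_none_mem isKConnected_octahedron (by simp)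

end Octahedron

section Assembly

open StraightTriangulation

theorem StraightTriangulation.not_isThreeCut_of_mem_stackFacets [Finite V] [DecidableEq V]
    {G : SimpleGraph V} {T : Set (Finset V)} {t : Finset V} (hG : IsKConnected 3 G)
    (ht : G.IsNClique 3 t) (hT : ∀ u ∈ T, ¬ IsThreeCut G u) {s : Finset (Option V)}
    (hs : s ∈ stackFacets T t) : ¬ IsThreeCut (stackGraph G t) s := by
  rcases hs with ⟨u, hu, hne, rfl⟩ | ⟨i, -, rfl⟩
  · rw [Finset.coe_map, Function.Embedding.some_apply,
      isThreeCut_stackGraph_image ht (by exact_mod_cast hne)]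
    exact hT u hu
  · exact not_isThreeCut_stackGraph_of_none_mem hG (by simp)

/-- There is a drawn 3-connected triangulation with `c` 3-cuts, none of which bounds a face of the
drawing, and a set of six vertices whose removal leaves at least `n` components and which spans at
least `k` bounded faces. -/
def HasSpannedFacets (k n c : ℕ) : Prop :=
  ∃ (V : Type) (_ : Fintype V) (_ : DecidableEq V) (G : SimpleGraph V)
    (D : StraightTriangulation G) (X : Finset V) (S : Finset (Finset V)),
    IsKConnected 3 G ∧ (∀ t ∈ D.facets, ¬ IsThreeCut G t) ∧
    {S : Set V | IsThreeCut G S}.ncard = c ∧ X.card = 6 ∧ Scatters G X n ∧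
    S.card = k ∧ ∀ t ∈ S, t ∈ D.facets ∧ t ⊆ X

theorem HasSpannedFacets.stack_spanned {k n c : ℕ} (h : HasSpannedFacets (k + 1) n c) :
    HasSpannedFacets k (n + 1) (c + 1) := by
  obtain ⟨V, _, _, G, D, X, S, hG, hD, hc, hX, hn, hS, hSX⟩ := h
  obtain ⟨t, htS⟩ : S.Nonempty := Finset.card_pos.1 (by omega)
  obtain ⟨ht, htX⟩ := hSX t htS
  have hcl := D.isNClique t ht
  refine ⟨Option V, inferInstance, inferInstance, stackGraph G t, D.stack t ht,
    X.map Function.Embedding.some,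
    (S.erase t).map ⟨Finset.map Function.Embedding.some, Finset.map_injective _⟩,
    isKConnected_stackGraph hG hcl, fun _ => not_isThreeCut_of_mem_stackFacets hG hcl hD, ?_,
    by simpa using hX, hn.stackGraph_of_subset htX, ?_, ?_⟩
  · rw [ncard_threeCuts_stackGraph hG hcl (hD t ht), hc]
  · rw [Finset.card_map, Finset.card_erase_of_mem htS, hS, Nat.add_sub_cancel]
  · intro u' hu'
    obtain ⟨u, hu, rfl⟩ := Finset.mem_map.1 hu'
    obtain ⟨hne, huS⟩ := Finset.mem_erase.1 hu
    exact ⟨Or.inl ⟨u, (hSX u huS).1, hne, rfl⟩, Finset.map_subset_map.2 (hSX u huS).2⟩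

theorem HasSpannedFacets.stack_any {k n c : ℕ} (h : HasSpannedFacets k n c) :
    HasSpannedFacets 0 n (c + 1) := by
  obtain ⟨V, _, _, G, D, X, -, hG, hD, hc, hX, hn, -⟩ := h
  obtain ⟨t, ht, -⟩ := D.exists_vertex_mem (D.corner 0)
  have hcl := D.isNClique t ht
  refine ⟨Option V, inferInstance, inferInstance, stackGraph G t, D.stack t ht,
    X.map Function.Embedding.some, ∅,
    isKConnected_stackGraph hG hcl, fun _ => not_isThreeCut_of_mem_stackFacets hG hcl hD, ?_,
    by simpa using hX, hn.stackGraph_of_isClique hcl.1, rfl, by simp⟩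
  rw [ncard_threeCuts_stackGraph hG hcl (hD t ht), hc]

theorem hasSpannedFacets_cappedOctahedron : HasSpannedFacets 7 1 1 := by
  refine ⟨_, inferInstance, inferInstance, cappedOctahedron, cappedTriangulation,
    Finset.univ.map Function.Embedding.some,
    (Finset.univ.filter fun b : Bool × Bool × Bool => (b.1 && b.2.1 && b.2.2) = false).image
      fun b => octFacet b.1 b.2.1 b.2.2,
    isKConnected_stackGraph isKConnected_octahedron isNClique_octahedronFace,
    fun _ => not_isThreeCut_of_mem_cappedFacets, ?_, by simp, ?_, by decide, ?_⟩
  · rw [ncard_threeCuts_stackGraph isKConnected_octahedron isNClique_octahedronFace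
      (not_isThreeCut_octahedron _)]
    simp [not_isThreeCut_octahedron]
  · exact Scatters.stackGraph_of_subset (n := 0) ⟨fun _ => 0, by simp, by simp⟩
      (Finset.subset_univ _)
  · intro s hs
    obtain ⟨⟨p, q, r⟩, hb, rfl⟩ := Finset.mem_image.1 hs
    exact ⟨Or.inl ⟨p, q, r, (Finset.mem_filter.1 hb).2, rfl⟩,
      by simp [octFacet, Finset.insert_subset_iff]⟩

theorem hasSpannedFacets_of_eight_le {d : ℕ} (hd : 8 ≤ d) : HasSpannedFacets 0 8 d := by
  induction d, hd using Nat.le_induction with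
  | base =>
    exact hasSpannedFacets_cappedOctahedron.stack_spanned.stack_spanned.stack_spanned
      |>.stack_spanned.stack_spanned.stack_spanned.stack_spanned
  | succ d _ ih => exact ih.stack_any

end Assembly

/-- For every `d ≥ 8` there is a planar triangulation with exactly `d` 3-cuts that is not
traceable, and which even has scattering number at least 2. -/
theorem stmt17 (d : ℕ) (hd : 8 ≤ d) :
    ∃ (V : Type) (_ : Fintype V) (_ : DecidableEq V) (G : SimpleGraph V)
      (E : PlaneEmbedding G),
      IsKConnected 3 G ∧
      (∀ F : Set (ℝ × ℝ), E.IsFace F → E.FaceIsTriangle F) ∧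
      {S : Set V | IsThreeCut G S}.ncard = d ∧
      (¬ ∃ (a b : V) (p : G.Walk a b), p.IsHamiltonian) ∧
      ∃ X : Set V, X.ncard + 2 ≤ Nat.card (G.induce (Xᶜ : Set V)).ConnectedComponent := by
  obtain ⟨V, _, _, G, D, X, -, hG, -, hc, hX, hn, -⟩ := hasSpannedFacets_of_eight_le hd
  refine ⟨V, inferInstance, inferInstance, G, D.toPlaneEmbedding, hG,
    fun _ => D.isFace_faceIsTriangle, hc, ?_, X, ?_⟩
  · rintro ⟨a, b, p, hp⟩
    exact hn.not_isHamiltonian (by omega) p hp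
  · rw [Set.ncard_coe_finset, hX]
    exact hn.le_card_connectedComponent
end

section
/- Let G be a 3-connected planar graph with at most d 3-cuts, where d ≥ 4. Then for every vertex cutset S of G, the number of components of G - S is at most |S| - 2 + ⌊d/2⌋. In particular, if d ≤ 5 then G is 1-tough, and if d ≤ 7 then the scattering number of G is at most 1. -/
open SimpleGraph Set

variable {V : Type*}

instance : ContractibleSpace unitInterval :=
  (convex_Icc (0 : ℝ) 1).contractibleSpace ⟨0, by simp⟩

instance : LocallyPathConnectedSpace unitInterval :=
  (convex_Icc (0 : ℝ) 1).locallyPathConnectedSpace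

/-- A nowhere vanishing continuous function on a simply connected space has a logarithm. -/
lemma exists_continuous_log {A : Type*} [TopologicalSpace A] [SimplyConnectedSpace A]
    [LocallyPathConnectedSpace A] (f : C(A, ℂ)) (hf : ∀ a, f a ≠ 0) :
    ∃ L : C(A, ℂ), ∀ a, Complex.exp (L a) = f a := by
  obtain ⟨a⟩ : Nonempty A := inferInstance
  obtain ⟨L, ⟨-, hL⟩, -⟩ := Complex.isCoveringMapOn_exp.existsUnique_continuousMap_lifts f
    (a₀ := a) (e₀ := Complex.log (f a)) (Complex.exp_log (hf a)) hf
  exact ⟨L, fun a => congrFun hL a⟩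

lemma log_increment_unique (L L' : C(unitInterval, ℂ)) (k : ℂ)
    (h : ∀ t, Complex.exp (L t) = k * Complex.exp (L' t)) :
    L 1 - L 0 = L' 1 - L' 0 := by
  have hk : ∀ t, Complex.exp ((L - L') t) = k := fun t => by
    rw [ContinuousMap.sub_apply, Complex.exp_sub, h t, mul_div_assoc,
      div_self (Complex.exp_ne_zero _), mul_one]
  have hk0 : k ≠ 0 := hk 0 ▸ Complex.exp_ne_zero _
  obtain ⟨F, -, hF⟩ := Complex.isCoveringMapOn_exp.existsUnique_continuousMap_lifts
    (ContinuousMap.const unitInterval k) (a₀ := 0) (e₀ := (L - L') 0) (hk 0) (fun _ => hk0)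
  have h1 := hF (L - L') ⟨rfl, funext hk⟩
  have h2 := hF (ContinuousMap.const _ ((L - L') 0)) ⟨rfl, funext fun _ => hk 0⟩
  have := DFunLike.congr_fun (h1.trans h2.symm) 1
  simp only [ContinuousMap.sub_apply, ContinuousMap.const_apply] at this
  linear_combination this

open Classical in
/-- The total change of a continuous logarithm of `f` along the unit interval
(zero when `f` vanishes somewhere). -/
noncomputable def logIncrement (f : C(unitInterval, ℂ)) : ℂ :=
  if h : ∃ L : C(unitInterval, ℂ), ∀ t, Complex.exp (L t) = f t then
    h.choose 1 - h.choose 0 else 0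

/-- The increment can be computed from a logarithm of any constant multiple. -/
lemma logIncrement_eq (f L : C(unitInterval, ℂ)) (k : ℂ)
    (hL : ∀ t, Complex.exp (L t) = k * f t) : logIncrement f = L 1 - L 0 := by
  have hf : ∀ t, f t ≠ 0 := fun t h0 => Complex.exp_ne_zero (L t) (by rw [hL, h0, mul_zero])
  have h := exists_continuous_log f hf
  rw [logIncrement, dif_pos h]
  exact (log_increment_unique _ _ k fun t => by rw [hL, h.choose_spec]).symm

lemma logIncrement_eq_log (f : C(unitInterval, ℂ)) (hf : ∀ t, f t ≠ 0) :
    ∃ n : ℤ, logIncrement f =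
      Complex.log (f 1) - Complex.log (f 0) + 2 * n * (Real.pi * Complex.I) := by
  obtain ⟨L, hL⟩ := exists_continuous_log f hf
  have key : ∀ t, ∃ n : ℤ, L t = Complex.log (f t) + n * (2 * Real.pi * Complex.I) := fun t =>
    Complex.exp_eq_exp_iff_exists_int.1 (by rw [hL, Complex.exp_log (hf t)])
  obtain ⟨n, hn⟩ := key 1
  obtain ⟨m, hm⟩ := key 0
  refine ⟨n - m, ?_⟩
  rw [logIncrement_eq f L 1 (by simpa using hL), hn, hm]
  push_cast
  ring

lemma log_sub_comm_odd {z w : ℂ} (h : z ≠ w) : ∃ m : ℤ, Complex.log (z - w) =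
    Complex.log (w - z) + (2 * m + 1) * (Real.pi * Complex.I) := by
  obtain ⟨n, hn⟩ := Complex.exp_eq_exp_iff_exists_int.1
    (show Complex.exp (Complex.log (z - w)) =
      Complex.exp (Complex.log (w - z) + Real.pi * Complex.I) by
      rw [Complex.exp_add, Complex.exp_log (sub_ne_zero.2 h),
        Complex.exp_log (sub_ne_zero.2 h.symm), Complex.exp_pi_mul_I]; ring)
  exact ⟨n, by rw [hn]; ring⟩

/-- The increments of `log (e s - f t)` along the boundary of the unit square cancel. -/
lemma logIncrement_square (e f : C(unitInterval, ℂ)) (h : ∀ s t, e s ≠ f t) :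
    logIncrement (e - .const _ (f 0)) + logIncrement (f - .const _ (e 1)) -
      logIncrement (e - .const _ (f 1)) - logIncrement (f - .const _ (e 0)) = 0 := by
  obtain ⟨L, hL⟩ := exists_continuous_log
    (⟨fun p => e p.1 - f p.2, by fun_prop⟩ : C(unitInterval × unitInterval, ℂ))
    (fun p => sub_ne_zero.2 (h p.1 p.2))
  simp only [ContinuousMap.coe_mk] at hL
  have hs : ∀ t, logIncrement (e - .const _ (f t)) = L (1, t) - L (0, t) := fun t =>
    logIncrement_eq _ (L.comp ⟨fun s => (s, t), by fun_prop⟩) 1 (by simp [hL])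
  have ht : ∀ s, logIncrement (f - .const _ (e s)) = L (s, 1) - L (s, 0) := fun s =>
    logIncrement_eq _ (L.comp ⟨fun t => (s, t), by fun_prop⟩) (-1) (by simp [hL])
  rw [hs, hs, ht, ht]
  ring

/-- Every drawing of `K₃,₃` in the plane has two independent edges that meet. -/
theorem exists_independent_paths_meet (x y : Fin 3 → ℂ) (γ : Fin 3 → Fin 3 → C(unitInterval, ℂ))
    (h0 : ∀ i j, γ i j 0 = x i) (h1 : ∀ i j, γ i j 1 = y j) :
    ∃ i j k l, i ≠ k ∧ j ≠ l ∧ ∃ s t, γ i j s = γ k l t := by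
  by_contra! hdis
  have other : ∀ i : Fin 3, ∃ k, k ≠ i := by decide
  have hxx : ∀ i k, i ≠ k → ∀ j t, γ i j t ≠ x k := fun i k hik j t => by
    obtain ⟨l, hl⟩ := other j
    rw [← h0 k l]; exact hdis i j k l hik hl.symm t 0
  have hyy : ∀ j l, j ≠ l → ∀ i t, γ i j t ≠ y l := fun j l hjl i t => by
    obtain ⟨k, hk⟩ := other i
    rw [← h1 k l]; exact hdis i j k l hk.symm hjl t 1
  have hyx : ∀ j k, y j ≠ x k := fun j k => by
    obtain ⟨i, hi⟩ := other k
    rw [← h1 i j]; exact hxx i k hi j 1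
  have ha : ∀ i k, ∃ m : ℤ, i ≠ k → Complex.log (x i - x k) =
      Complex.log (x k - x i) + (2 * m + 1) * (Real.pi * Complex.I) := fun i k => by
    by_cases hik : i = k
    · exact ⟨0, fun h => (h hik).elim⟩
    · exact (log_sub_comm_odd (h0 i 0 ▸ hxx i k hik 0 0)).imp fun _ h _ => h
  have hb : ∀ j l, ∃ m : ℤ, j ≠ l → Complex.log (y j - y l) =
      Complex.log (y l - y j) + (2 * m + 1) * (Real.pi * Complex.I) := fun j l => by
    by_cases hjl : j = l
    · exact ⟨0, fun h => (h hjl).elim⟩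
    · exact (log_sub_comm_odd (h1 0 j ▸ hyy j l hjl 0 1)).imp fun _ h _ => h
  have hn : ∀ k i j, ∃ n : ℤ, i ≠ k → logIncrement (γ i j - .const _ (x k)) =
      Complex.log (y j - x k) - Complex.log (x i - x k) + 2 * n * (Real.pi * Complex.I) := by
    intro k i j
    by_cases hik : i = k
    · exact ⟨0, fun h => (h hik).elim⟩
    · refine (logIncrement_eq_log (γ i j - .const _ (x k))
        fun t => sub_ne_zero.2 (hxx i k hik j t)).imp fun _ h _ => ?_
      simpa [h0, h1] using h
  have hm : ∀ l i j, ∃ n : ℤ, j ≠ l → logIncrement (γ i j - .const _ (y l)) =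
      Complex.log (y j - y l) - Complex.log (x i - y l) + 2 * n * (Real.pi * Complex.I) := by
    intro l i j
    by_cases hjl : j = l
    · exact ⟨0, fun h => (h hjl).elim⟩
    · refine (logIncrement_eq_log (γ i j - .const _ (y l))
        fun t => sub_ne_zero.2 (hyy j l hjl i t)).imp fun _ h _ => ?_
      simpa [h0, h1] using h
  choose a ha using ha
  choose b hb using hb
  choose c hc using fun j k => log_sub_comm_odd (hyx j k)
  choose n hn using hn
  choose m hm using hm
  have hpi : (Real.pi * Complex.I : ℂ) ≠ 0 := by simp [Real.pi_ne_zero]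
  have hbs : ∀ j l, j ≠ l → b j l + b l j = -1 := fun j l hjl => by
    have h : ((b j l + b l j + 1 : ℤ) : ℂ) * (Real.pi * Complex.I) = 0 := by
      push_cast
      linear_combination (-1 / 2 : ℂ) * hb j l hjl - (1 / 2 : ℂ) * hb l j hjl.symm
    have := (mul_eq_zero.1 h).resolve_right hpi
    have : b j l + b l j + 1 = 0 := by exact_mod_cast this
    omega
  have sq : ∀ i k j l, i ≠ k → j ≠ l →
      c j k - a i k - b j l - c l i - 1 + n k i j + m j k l - m l i j - n i k l = 0 := by
    intro i k j l hik hjl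
    have hsq := logIncrement_square (γ i j) (γ k l) (fun s t => hdis i j k l hik hjl s t)
    rw [h0, h0, h1, h1, hn k i j hik, hm j k l hjl.symm, hm l i j hjl, hn i k l hik.symm] at hsq
    have h : ((c j k - a i k - b j l - c l i - 1 + n k i j + m j k l - m l i j - n i k l : ℤ) : ℂ)
        * (Real.pi * Complex.I) = 0 := by
      push_cast
      linear_combination (1 / 2 : ℂ) * hsq - (1 / 2 : ℂ) * hc j k + (1 / 2 : ℂ) * ha i k hik
        + (1 / 2 : ℂ) * hb j l hjl + (1 / 2 : ℂ) * hc l i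
    exact_mod_cast (mul_eq_zero.1 h).resolve_right hpi
  have h01 := fun j l => sq 0 1 j l (by decide)
  have h02 := fun j l => sq 0 2 j l (by decide)
  have h12 := fun j l => sq 1 2 j l (by decide)
  have b01 := hbs 0 1 (by decide)
  have b02 := hbs 0 2 (by decide)
  have b12 := hbs 1 2 (by decide)
  have g : ∀ (f : Fin 3 → Fin 3 → ℤ), (∀ j l, j ≠ l → f j l = 0) →
      f 0 1 + f 1 0 + f 0 2 + f 2 0 + f 1 2 + f 2 1 = 0 := fun f hf => by
    simp [hf]
  have g01 := g _ h01
  have g02 := g _ h02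
  have g12 := g _ h12
  clear h01 h02 h12 sq hbs g
  omega
/-- `G` has a `K₃,₃` minor, given by six disjoint connected branch sets. -/
def HasK33Minor (G : SimpleGraph V) : Prop :=
  ∃ X Y : Fin 3 → Set V,
    (∀ i, (G.induce (X i)).Connected) ∧ (∀ j, (G.induce (Y j)).Connected) ∧
    (∀ i k, i ≠ k → Disjoint (X i) (X k)) ∧ (∀ j l, j ≠ l → Disjoint (Y j) (Y l)) ∧
    (∀ i j, Disjoint (X i) (Y j)) ∧ ∀ i j, ∃ u ∈ X i, ∃ v ∈ Y j, G.Adj u v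

/-- The part of the drawing covered by the subgraph induced on `T`. -/
def PlaneEmbedding.drawingOn {G : SimpleGraph V} (E : PlaneEmbedding G) (T : Set V) :
    Set (ℝ × ℝ) :=
  {p | (∃ v ∈ T, E.vertexMap v = p) ∨
    ∃ a ∈ T, ∃ b ∈ T, ∃ h : G.Adj a b, p ∈ Set.range (E.edgeMap h)}

lemma PlaneEmbedding.disjoint_drawingOn {G : SimpleGraph V} (E : PlaneEmbedding G)
    {T T' : Set V} (hT : Disjoint T T') : Disjoint (E.drawingOn T) (E.drawingOn T') := by
  rw [Set.disjoint_left] at hT ⊢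
  rintro p (⟨v, hv, rfl⟩ | ⟨a, ha, b, hb, h, hp⟩) (⟨w, hw, hvw⟩ | ⟨c, hc, d, hd, h', hp'⟩)
  · exact hT hv (E.vertex_inj hvw ▸ hw)
  · rcases E.edge_no_vertex h' v hp' with rfl | rfl
    exacts [hT hv hc, hT hv hd]
  · rcases E.edge_no_vertex h w (hvw ▸ hp) with rfl | rfl
    exacts [hT ha hw, hT hb hw]
  · have hne : s(a, b) ≠ s(c, d) := by
      intro heq
      rcases Sym2.eq_iff.1 heq with ⟨rfl, -⟩ | ⟨rfl, -⟩
      exacts [hT ha hc, hT ha hd]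
    obtain ⟨w, ⟨hw, hw'⟩, -⟩ := E.edge_int h h' hne ⟨hp, hp'⟩
    rcases hw with rfl | rfl <;> rcases hw' with rfl | rfl
    exacts [hT ha hc, hT ha hd, hT hb hc, hT hb hd]

lemma PlaneEmbedding.joinedIn_drawingOn {G : SimpleGraph V} (E : PlaneEmbedding G) {T : Set V}
    (hT : (G.induce T).Connected) {u v : V} (hu : u ∈ T) (hv : v ∈ T) :
    JoinedIn (E.drawingOn T) (E.vertexMap u) (E.vertexMap v) := by
  obtain ⟨w⟩ := hT.preconnected ⟨u, hu⟩ ⟨v, hv⟩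
  suffices ∀ (a b : T), (G.induce T).Walk a b →
      JoinedIn (E.drawingOn T) (E.vertexMap a) (E.vertexMap b) from this _ _ w
  intro a b w
  induction w with
  | nil => exact JoinedIn.refl (Or.inl ⟨_, Subtype.coe_prop _, rfl⟩)
  | @cons a b c h _ ih =>
    have h' : G.Adj a b := h
    refine JoinedIn.trans ⟨⟨E.edgeMap h', E.edge_start h', E.edge_end h'⟩, fun t => ?_⟩ ih
    exact Or.inr ⟨a, a.2, b, b.2, h', t, rfl⟩

theorem IsPlanar.not_hasK33Minor {G : SimpleGraph V} (hG : IsPlanar G) : ¬ HasK33Minor G := by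
  rintro ⟨X, Y, hX, hY, hXX, hYY, hXY, hadj⟩
  obtain ⟨E⟩ := hG
  let x := fun i => (hX i).nonempty.some
  let y := fun j => (hY j).nonempty.some
  have hconn : ∀ i j, (G.induce (X i ∪ Y j)).Connected := fun i j => by
    obtain ⟨u, hu, v, hv, h⟩ := hadj i j
    exact connected_induce_union (hX i).preconnected (hY j).preconnected hu hv h
  have hjoin : ∀ i j, JoinedIn (E.drawingOn (X i ∪ Y j)) (E.vertexMap (x i))
      (E.vertexMap (y j)) := fun i j =>
    E.joinedIn_drawingOn (hconn i j) (Or.inl (x i).2) (Or.inr (y j).2)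
  let γ := fun i j => (hjoin i j).somePath
  have hγ : ∀ i j t, γ i j t ∈ E.drawingOn (X i ∪ Y j) := fun i j => (hjoin i j).somePath_mem
  let φ : C(ℝ × ℝ, ℂ) := ⟨Complex.equivRealProdCLM.symm, by fun_prop⟩
  have hφ : Function.Injective φ := Complex.equivRealProdCLM.symm.injective
  obtain ⟨i, j, k, l, hik, hjl, s, t, hst⟩ := exists_independent_paths_meet
    (fun i => φ (E.vertexMap (x i))) (fun j => φ (E.vertexMap (y j)))
    (fun i j => φ.comp (γ i j).toContinuousMap) (by simp) (by simp)
  have hdis : Disjoint (X i ∪ Y j) (X k ∪ Y l) := by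
    rw [Set.disjoint_union_left, Set.disjoint_union_right, Set.disjoint_union_right]
    exact ⟨⟨hXX i k hik, hXY i l⟩, (hXY k j).symm, hYY j l hjl⟩
  refine Set.disjoint_left.1 (E.disjoint_drawingOn hdis) (hγ i j s) ?_
  rw [show γ i j s = γ k l t from hφ hst]
  exact hγ k l t

/-- Disjoint connected branch sets `X i` for `i ∈ A ∪ C`, together with a set `E` of pairs from
`A × C` whose branch sets are joined by an edge: a bipartite minor of `G`. -/
structure IsBipartiteModel {ι : Type*} [DecidableEq ι] (G : SimpleGraph V) (X : ι → Set V)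
    (A C : Finset ι) (E : Finset (ι × ι)) : Prop where
  disjoint_sides : Disjoint A C
  mem_sides : ∀ a c, (a, c) ∈ E → a ∈ A ∧ c ∈ C
  connected : ∀ i ∈ A ∪ C, (G.induce (X i)).Connected
  disjoint : ∀ i ∈ A ∪ C, ∀ j ∈ A ∪ C, i ≠ j → Disjoint (X i) (X j)
  adj : ∀ a c, (a, c) ∈ E → ∃ u ∈ X a, ∃ v ∈ X c, G.Adj u v

namespace IsBipartiteModel

variable {ι : Type*} [DecidableEq ι] {G : SimpleGraph V} {X : ι → Set V} {A C : Finset ι}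
  {E : Finset (ι × ι)}

lemma swap (h : IsBipartiteModel G X A C E) :
    IsBipartiteModel G X C A (E.map (Equiv.prodComm ι ι).toEmbedding) where
  disjoint_sides := h.disjoint_sides.symm
  mem_sides a c hac := by
    have := h.mem_sides c a (by simpa using hac)
    tauto
  connected i hi := h.connected i (Finset.union_comm A C ▸ hi)
  disjoint i hi j hj := h.disjoint i (Finset.union_comm A C ▸ hi) j (Finset.union_comm A C ▸ hj)
  adj a c hac := by
    obtain ⟨u, hu, v, hv, huv⟩ := h.adj c a (by simpa using hac)
    exact ⟨v, hv, u, hu, huv.symm⟩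

lemma mono (h : IsBipartiteModel G X A C E) {A' C' : Finset ι} {E' : Finset (ι × ι)}
    (hA : A' ⊆ A) (hC : C' ⊆ C) (hE : E' ⊆ E) (hE' : ∀ a c, (a, c) ∈ E' → a ∈ A' ∧ c ∈ C') :
    IsBipartiteModel G X A' C' E' where
  disjoint_sides := Finset.disjoint_of_subset_left hA
    (Finset.disjoint_of_subset_right hC h.disjoint_sides)
  mem_sides := hE'
  connected i hi := h.connected i (Finset.union_subset_union hA hC hi)
  disjoint i hi j hj := h.disjoint i (Finset.union_subset_union hA hC hi) j
    (Finset.union_subset_union hA hC hj)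
  adj a c hac := h.adj a c (hE hac)

lemma card_le_mul (h : IsBipartiteModel G X A C E) : E.card ≤ A.card * C.card := by
  rw [← Finset.card_product]
  exact Finset.card_le_card fun p hp => Finset.mem_product.2 (h.mem_sides p.1 p.2 hp)

/-- Contracting a path `a₁ - b - a₂` and keeping only the edges between the two sides. -/
lemma contract (h : IsBipartiteModel G X A C E) {a₁ a₂ b : ι} (hne : a₁ ≠ a₂)
    (h₁ : (a₁, b) ∈ E) (h₂ : (a₂, b) ∈ E) :
    IsBipartiteModel G (Function.update X a₁ (X a₁ ∪ X b ∪ X a₂)) (A.erase a₂) (C.erase b)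
      ((E.filter (fun p => p.2 ≠ b)).image (fun p => (if p.1 = a₂ then a₁ else p.1, p.2))) := by
  obtain ⟨ha₁, hb⟩ := h.mem_sides _ _ h₁
  obtain ⟨ha₂, -⟩ := h.mem_sides _ _ h₂
  have hAC := Finset.disjoint_left.1 h.disjoint_sides
  have hsub : ∀ i ∈ A.erase a₂ ∪ C.erase b, i ∈ A ∪ C ∧ i ≠ a₂ ∧ i ≠ b := by
    intro i hi
    simp only [Finset.mem_union, Finset.mem_erase] at hi ⊢
    grind
  have hm : ∀ i ∈ A ∪ C, i ≠ a₂ → i ≠ b → i ≠ a₁ → Disjoint (X a₁ ∪ X b ∪ X a₂) (X i) := by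
    intro i hi h2 hb' h1
    simp only [Set.disjoint_union_left]
    exact ⟨⟨h.disjoint _ (by simp [ha₁]) _ hi h1.symm, h.disjoint _ (by simp [hb]) _ hi hb'.symm⟩,
      h.disjoint _ (by simp [ha₂]) _ hi h2.symm⟩
  refine ⟨?_, ?_, ?_, ?_, ?_⟩
  · exact Finset.disjoint_of_subset_left (Finset.erase_subset _ _)
      (Finset.disjoint_of_subset_right (Finset.erase_subset _ _) h.disjoint_sides)
  · intro a c hac
    simp only [Finset.mem_image, Finset.mem_filter, Prod.exists, Prod.mk.injEq] at hac
    obtain ⟨a', c', ⟨hE, hcb⟩, rfl, rfl⟩ := hac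
    have := h.mem_sides _ _ hE
    simp only [Finset.mem_erase]
    grind
  · intro i hi
    obtain ⟨hi, h2, hb'⟩ := hsub i hi
    by_cases h1 : i = a₁
    · subst h1
      rw [Function.update_self]
      obtain ⟨u, hu, v, hv, huv⟩ := h.adj _ _ h₁
      obtain ⟨u', hu', v', hv', huv'⟩ := h.adj _ _ h₂
      have hc := connected_induce_union (h.connected i (by simp [ha₁])).preconnected
        (h.connected b (by simp [hb])).preconnected hu hv huv
      exact connected_induce_union hc.preconnected
        (h.connected a₂ (by simp [ha₂])).preconnected (Or.inr hv') hu' huv'.symm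
    · rw [Function.update_of_ne h1]
      exact h.connected i hi
  · intro i hi j hj hij
    obtain ⟨hi, hi2, hib⟩ := hsub i hi
    obtain ⟨hj, hj2, hjb⟩ := hsub j hj
    by_cases h1 : i = a₁
    · subst h1
      rw [Function.update_self, Function.update_of_ne hij.symm]
      exact hm j hj hj2 hjb hij.symm
    · by_cases h1' : j = a₁
      · subst h1'
        rw [Function.update_self, Function.update_of_ne hij]
        exact (hm i hi hi2 hib hij).symm
      · rw [Function.update_of_ne h1, Function.update_of_ne h1']
        exact h.disjoint i hi j hj hij
  · intro a c hac
    simp only [Finset.mem_image, Finset.mem_filter, Prod.exists, Prod.mk.injEq] at hac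
    obtain ⟨a', c', ⟨hE, hcb⟩, rfl, rfl⟩ := hac
    obtain ⟨ha', hc'⟩ := h.mem_sides _ _ hE
    have hc1 : c' ≠ a₁ := fun he => hAC ha₁ (he ▸ hc')
    obtain ⟨u, hu, v, hv, huv⟩ := h.adj _ _ hE
    refine ⟨u, ?_, v, by rwa [Function.update_of_ne hc1], huv⟩
    split_ifs with ha
    · subst ha
      rw [Function.update_self]
      exact Or.inr hu
    · by_cases h1 : a' = a₁
      · subst h1
        rw [Function.update_self]
        exact Or.inl (Or.inl hu)
      · rwa [Function.update_of_ne h1]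

lemma card_contract {a₁ a₂ b : ι} (K : Finset ι)
    (hK : ∀ c, (a₁, c) ∈ E → (a₂, c) ∈ E → c ∈ K) (hb : b ∈ K) :
    E.card + 1 ≤ ((E.filter (fun p => p.2 ≠ b)).image
      (fun p => (if p.1 = a₂ then a₁ else p.1, p.2))).card +
      (E.filter (fun p => p.2 = b)).card + K.card := by
  set F := E.filter (fun p => p.2 ≠ b) with hF
  have hEF : (E.filter (fun p => p.2 = b)).card + F.card = E.card :=
    Finset.card_filter_add_card_filter_not _
  set D := (K.erase b).image (fun c => (a₂, c)) with hD
  have hDc : D.card + 1 ≤ K.card := by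
    rw [← Finset.card_erase_add_one hb]
    exact Nat.add_le_add_right Finset.card_image_le 1
  have hFD : F.card ≤ (F \ D).card + D.card := by
    have := Finset.le_card_sdiff D F
    omega
  have himg : (F \ D).card ≤
      (F.image (fun p => (if p.1 = a₂ then a₁ else p.1, p.2))).card := by
    have hinj : Set.InjOn (fun p : ι × ι => (if p.1 = a₂ then a₁ else p.1, p.2))
        ((F \ D : Finset (ι × ι)) : Set (ι × ι)) := by
      rintro ⟨a, c⟩ h ⟨a', c'⟩ h' heq
      simp only [hF, hD, Finset.coe_sdiff, Set.mem_sdiff, Finset.mem_coe, Finset.mem_filter,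
        Finset.mem_image, Finset.mem_erase, Prod.mk.injEq] at h h' heq
      grind
    rw [← Finset.card_image_of_injOn hinj]
    exact Finset.card_le_card (Finset.image_subset_image Finset.sdiff_subset)
  omega

/-- A union of branch sets that are linked to each other through edges of the model is
connected. -/
lemma connected_biUnion (h : IsBipartiteModel G X A C E) {U : Finset ι} (hU : U ⊆ A ∪ C) {a : ι}
    (ha : a ∈ U)
    (hlink : ∀ i ∈ U, Relation.ReflTransGen
      (fun i j => i ∈ U ∧ j ∈ U ∧ ((i, j) ∈ E ∨ (j, i) ∈ E)) a i) :
    (G.induce (⋃ i ∈ U, X i)).Connected := by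
  obtain ⟨u, hu⟩ := (h.connected a (hU ha)).nonempty
  have key : ∀ i, Relation.ReflTransGen
      (fun i j => i ∈ U ∧ j ∈ U ∧ ((i, j) ∈ E ∨ (j, i) ∈ E)) a i →
      ∃ T ⊆ ⋃ i ∈ U, X i, u ∈ T ∧ X i ⊆ T ∧ (G.induce T).Connected := by
    intro i hi
    induction hi with
    | refl => exact ⟨X a, Set.subset_biUnion_of_mem (u := X) ha, hu, subset_rfl,
        h.connected a (hU ha)⟩
    | @tail i j _ hij ih =>
      obtain ⟨T, hT, huT, hiT, hTc⟩ := ih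
      obtain ⟨-, hj, hE⟩ := hij
      obtain ⟨v, hv, w, hw, hvw⟩ : ∃ v ∈ X i, ∃ w ∈ X j, G.Adj v w := by
        rcases hE with hE | hE
        · exact h.adj _ _ hE
        · obtain ⟨v, hv, w, hw, hvw⟩ := h.adj _ _ hE
          exact ⟨w, hw, v, hv, hvw.symm⟩
      exact ⟨T ∪ X j, Set.union_subset hT (Set.subset_biUnion_of_mem (u := X) hj), Or.inl huT,
        Set.subset_union_right, connected_induce_union hTc.preconnected
          (h.connected j (hU hj)).preconnected (hiT hv) hw hvw⟩
  refine G.induce_connected_of_patches u (Set.mem_biUnion ha hu) ?_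
  intro v hv
  obtain ⟨i, hi, hvi⟩ := Set.mem_iUnion₂.1 hv
  obtain ⟨T, hT, huT, hiT, hTc⟩ := key i (hlink i hi)
  exact ⟨T, hT, huT, hiT hvi, hTc.preconnected _ _⟩

/-- The bound on the number of edges holds for every model with fewer branch sets than
`A ∪ C`. -/
def SmallerBound (G : SimpleGraph V) (n : ℕ) (ι : Type*) [DecidableEq ι] : Prop :=
  ∀ (X : ι → Set V) (A C : Finset ι) (E : Finset (ι × ι)), IsBipartiteModel G X A C E →
    A.card + C.card < n → 3 ≤ A.card + C.card → E.card + 4 ≤ 2 * (A.card + C.card)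

lemma three_le_degree (h : IsBipartiteModel G X A C E)
    (ih : SmallerBound G (A.card + C.card) ι) (hn : 4 ≤ A.card + C.card)
    (hE : 2 * (A.card + C.card) < E.card + 4) {c : ι} (hc : c ∈ C) :
    3 ≤ (E.filter (fun p => p.2 = c)).card := by
  have hcard : (E.filter (fun p => p.2 = c)).card + (E.filter (fun p => p.2 ≠ c)).card = E.card :=
    Finset.card_filter_add_card_filter_not _
  have hC := Finset.card_erase_add_one hc
  have := ih X A (C.erase c) (E.filter (fun p => p.2 ≠ c))
    (h.mono subset_rfl (Finset.erase_subset _ _) (Finset.filter_subset _ _) (by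
      intro a c' hac
      rw [Finset.mem_filter] at hac
      have := h.mem_sides _ _ hac.1
      exact ⟨this.1, Finset.mem_erase.2 ⟨hac.2, this.2⟩⟩)) (by omega) (by omega)
  omega

lemma exists_third_neighbor {c a₁ a₂ : ι} (hc : 3 ≤ (E.filter (fun p => p.2 = c)).card) :
    ∃ a, a ≠ a₁ ∧ a ≠ a₂ ∧ (a, c) ∈ E := by
  by_contra! hno
  have : E.filter (fun p => p.2 = c) ⊆ {(a₁, c), (a₂, c)} := by
    rintro ⟨a, c'⟩ hp
    obtain ⟨hpE, hc'⟩ := Finset.mem_filter.1 hp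
    obtain rfl : c' = c := hc'
    by_contra hn
    simp only [Finset.mem_insert, Finset.mem_singleton, Prod.mk.injEq, and_true] at hn
    push Not at hn
    exact hno a hn.1 hn.2 hpE
  have := (Finset.card_le_card this).trans Finset.card_le_two
  omega

/-- If the common neighbours of `a₁` and `a₂` together with `a₁` and `a₂` do not separate the
model, there is a `K₃,₃` minor. -/
lemma hasK33Minor_of_linked (h : IsBipartiteModel G X A C E) {a₁ a₂ a₃ : ι} (hne : a₁ ≠ a₂)
    (ha₁ : a₁ ∈ A) (ha₂ : a₂ ∈ A) {K U : Finset ι} (hK3 : 3 ≤ K.card)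
    (hK : ∀ c ∈ K, (a₁, c) ∈ E ∧ (a₂, c) ∈ E ∧ ∃ a ∈ U, (a, c) ∈ E)
    (hU : U ⊆ A ∪ C) (hU₁ : a₁ ∉ U) (hU₂ : a₂ ∉ U) (hKU : ∀ c ∈ K, c ∉ U) (ha₃ : a₃ ∈ U)
    (hlink : ∀ i ∈ U, Relation.ReflTransGen
      (fun i j => i ∈ U ∧ j ∈ U ∧ ((i, j) ∈ E ∨ (j, i) ∈ E)) a₃ i) : HasK33Minor G := by
  obtain ⟨f, hf⟩ : ∃ f : Fin 3 ↪ ι, ∀ j, f j ∈ K := by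
    obtain ⟨K', hK', hc⟩ := Finset.exists_subset_card_eq hK3
    exact ⟨(K'.equivFinOfCardEq hc).symm.toEmbedding.trans (Function.Embedding.subtype _),
      fun j => hK' (Subtype.coe_prop _)⟩
  have hAC := Finset.disjoint_left.1 h.disjoint_sides
  have hKC : ∀ c ∈ K, c ∈ C := fun c hc => (h.mem_sides _ _ (hK c hc).1).2
  have hKm : ∀ c ∈ K, c ∈ A ∪ C := fun c hc => Finset.mem_union_right _ (hKC c hc)
  have hm₁ : a₁ ∈ A ∪ C := Finset.mem_union_left _ ha₁
  have hm₂ : a₂ ∈ A ∪ C := Finset.mem_union_left _ ha₂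
  have hUd : ∀ i ∈ A ∪ C, i ∉ U → Disjoint (X i) (⋃ i ∈ U, X i) := by
    intro i hi hiU
    rw [Set.disjoint_iUnion₂_right]
    exact fun j hj => h.disjoint i hi j (hU hj) (fun he => hiU (he ▸ hj))
  have hd₁₂ := h.disjoint a₁ hm₁ a₂ hm₂ hne
  have hd₁ := hUd a₁ hm₁ hU₁
  have hd₂ := hUd a₂ hm₂ hU₂
  refine ⟨![X a₁, X a₂, ⋃ i ∈ U, X i], fun j => X (f j), ?_, fun j => h.connected _ (hKm _ (hf j)),
    ?_, ?_, ?_, ?_⟩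
  · intro i
    fin_cases i
    exacts [h.connected _ hm₁, h.connected _ hm₂, h.connected_biUnion hU ha₃ hlink]
  · intro i k hik
    fin_cases i <;> fin_cases k
    exacts [(hik rfl).elim, hd₁₂, hd₁, hd₁₂.symm, (hik rfl).elim, hd₂, hd₁.symm, hd₂.symm,
      (hik rfl).elim]
  · exact fun j l hjl => h.disjoint _ (hKm _ (hf j)) _ (hKm _ (hf l)) (f.injective.ne hjl)
  · intro i j
    have hc := hKC _ (hf j)
    fin_cases i
    · exact h.disjoint _ hm₁ _ (hKm _ (hf j)) (fun he => hAC ha₁ (he ▸ hc))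
    · exact h.disjoint _ hm₂ _ (hKm _ (hf j)) (fun he => hAC ha₂ (he ▸ hc))
    · exact (hUd _ (hKm _ (hf j)) (hKU _ (hf j))).symm
  · intro i j
    obtain ⟨h₁, h₂, a, ha, h₃⟩ := hK _ (hf j)
    fin_cases i
    · exact h.adj _ _ h₁
    · exact h.adj _ _ h₂
    · obtain ⟨u, hu, hv⟩ := h.adj _ _ h₃
      exact ⟨u, Set.mem_biUnion ha hu, hv⟩

/-- A separation of the model along `a₁`, `a₂` and their common neighbours. -/
lemma card_le_of_separation (h : IsBipartiteModel G X A C E)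
    (ih : SmallerBound G (A.card + C.card) ι) {a₁ a₂ : ι} (hne : a₁ ≠ a₂)
    (ha₁ : a₁ ∈ A) (ha₂ : a₂ ∈ A) {K : Finset ι} (hK : ∀ c ∈ K, (a₁, c) ∈ E ∧ (a₂, c) ∈ E)
    (hK3 : 3 ≤ K.card) (Q : ι → Prop) (hQ₁ : ¬ Q a₁) (hQ₂ : ¬ Q a₂) (hQK : ∀ c ∈ K, ¬ Q c)
    (hQE : ∀ a c, (a, c) ∈ E → a ≠ a₁ → a ≠ a₂ → c ∉ K → (Q a ↔ Q c))
    (hQ : ∃ i ∈ A ∪ C, Q i) (hQ' : ∃ i ∈ A ∪ C, i ≠ a₁ ∧ i ≠ a₂ ∧ i ∉ K ∧ ¬ Q i) :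
    E.card + 4 ≤ 2 * (A.card + C.card) := by
  classical
  have hAC := Finset.disjoint_left.1 h.disjoint_sides
  have hKC : ∀ c ∈ K, c ∈ C := fun c hc => (h.mem_sides _ _ (hK c hc).1).2
  set A₁ := A.filter (fun a => a = a₁ ∨ a = a₂ ∨ Q a) with hA₁
  set A₂ := A.filter (fun a => ¬ Q a) with hA₂
  set C₁ := C.filter (fun c => c ∈ K ∨ Q c) with hC₁
  set C₂ := C.filter (fun c => ¬ Q c) with hC₂
  set E₁ := E.filter (fun p => p.1 ∈ A₁ ∧ p.2 ∈ C₁) with hE₁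
  set E₂ := E.filter (fun p => p.1 ∈ A₂ ∧ p.2 ∈ C₂) with hE₂
  have hAcard : A₁.card + A₂.card = A.card + 2 := by
    rw [← Finset.card_union_add_card_inter, show A₁ ∪ A₂ = A by ext; grind,
      show A₁ ∩ A₂ = {a₁, a₂} by ext; grind, Finset.card_pair hne]
  have hCcard : C₁.card + C₂.card = C.card + K.card := by
    rw [← Finset.card_union_add_card_inter, show C₁ ∪ C₂ = C by ext; grind,
      show C₁ ∩ C₂ = K by ext; grind]
  have hEcard : E.card + 2 * K.card ≤ E₁.card + E₂.card := by
    rw [← Finset.card_union_add_card_inter, show E₁ ∪ E₂ = E by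
      ext ⟨a, c⟩
      have := hQE a c
      have := h.mem_sides a c
      have q₁ : Q a → a ≠ a₁ := fun hq he => hQ₁ (he ▸ hq)
      have q₂ : Q a → a ≠ a₂ := fun hq he => hQ₂ (he ▸ hq)
      grind]
    have hsub : ({a₁, a₂} : Finset ι) ×ˢ K ⊆ E₁ ∩ E₂ := by
      rintro ⟨a, c⟩ hac
      simp only [Finset.mem_product, Finset.mem_insert, Finset.mem_singleton] at hac
      have := hK c hac.2
      grind
    have := Finset.card_le_card hsub
    rw [Finset.card_product, Finset.card_pair hne] at this
    omega
  have hK₁ : K.card ≤ C₁.card := Finset.card_le_card fun c hc => by grind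
  have hK₂ : K.card ≤ C₂.card := Finset.card_le_card fun c hc => by grind
  have hA₁s : A₁ ⊆ A := Finset.filter_subset _ _
  have hA₂s : A₂ ⊆ A := Finset.filter_subset _ _
  have hC₁s : C₁ ⊆ C := Finset.filter_subset _ _
  have hC₂s : C₂ ⊆ C := Finset.filter_subset _ _
  have hlt : ∀ A' C' : Finset ι, A' ⊆ A → C' ⊆ C → ∀ i ∈ A ∪ C, i ∉ A' → i ∉ C' →
      A'.card + C'.card < A.card + C.card := by
    intro A' C' hA' hC' i hi hiA hiC
    rcases Finset.mem_union.1 hi with hi | hi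
    · have := Finset.card_lt_card (Finset.ssubset_iff_subset_ne.2 ⟨hA', fun he => hiA (he ▸ hi)⟩)
      have := Finset.card_le_card hC'
      omega
    · have := Finset.card_lt_card (Finset.ssubset_iff_subset_ne.2 ⟨hC', fun he => hiC (he ▸ hi)⟩)
      have := Finset.card_le_card hA'
      omega
  obtain ⟨i, hi, hQi⟩ := hQ
  obtain ⟨j, hj, hj₁, hj₂, hjK, hQj⟩ := hQ'
  have b₁ := ih X A₁ C₁ E₁ (h.mono hA₁s hC₁s (Finset.filter_subset _ _)
    (fun a c hac => (Finset.mem_filter.1 hac).2))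
    (hlt _ _ hA₁s hC₁s j hj (by grind) (by grind)) (by omega)
  have b₂ := ih X A₂ C₂ E₂ (h.mono hA₂s hC₂s (Finset.filter_subset _ _)
    (fun a c hac => (Finset.mem_filter.1 hac).2))
    (hlt _ _ hA₂s hC₂s i hi (by grind) (by grind)) (by omega)
  omega

/-- The edge bound for a model having a branch set of degree three in `C`. -/
lemma card_le_of_degree_three (hG : ¬ HasK33Minor G) (h : IsBipartiteModel G X A C E)
    (ih : SmallerBound G (A.card + C.card) ι) (hn : 5 ≤ A.card + C.card)
    (hdeg : ∀ c ∈ C, 3 ≤ (E.filter (fun p => p.2 = c)).card) {b : ι} (hb : b ∈ C)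
    (hb3 : (E.filter (fun p => p.2 = b)).card = 3) :
    E.card + 4 ≤ 2 * (A.card + C.card) := by
  classical
  obtain ⟨⟨a₁, b₁⟩, hp⟩ := Finset.card_pos.1 (by omega : 0 < (E.filter (fun p => p.2 = b)).card)
  obtain ⟨h₁, rfl⟩ : (a₁, b₁) ∈ E ∧ b₁ = b := Finset.mem_filter.1 hp
  obtain ⟨a₂, hne, -, h₂⟩ := exists_third_neighbor (a₁ := a₁) (a₂ := a₁) (hdeg b₁ hb)
  obtain ⟨a₃, h31, h32, h₃⟩ := exists_third_neighbor (a₁ := a₁) (a₂ := a₂) (hdeg b₁ hb)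
  have ha₁ := (h.mem_sides _ _ h₁).1
  have ha₂ := (h.mem_sides _ _ h₂).1
  have ha₃ := (h.mem_sides _ _ h₃).1
  have hAC := Finset.disjoint_left.1 h.disjoint_sides
  set K := C.filter (fun c => (a₁, c) ∈ E ∧ (a₂, c) ∈ E) with hKdef
  have hK : ∀ c ∈ K, (a₁, c) ∈ E ∧ (a₂, c) ∈ E := fun c hc => (Finset.mem_filter.1 hc).2
  have hKC : ∀ c ∈ K, c ∈ C := fun c hc => (Finset.mem_filter.1 hc).1
  have hbK : b₁ ∈ K := Finset.mem_filter.2 ⟨hb, h₁, h₂⟩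
  rcases Nat.lt_or_ge K.card 3 with hK3 | hK3
  · have hcard := card_contract (E := E) (a₁ := a₁) (a₂ := a₂) K
      (fun c hc hc' => Finset.mem_filter.2 ⟨(h.mem_sides _ _ hc).2, hc, hc'⟩) hbK
    have hA := Finset.card_erase_add_one ha₂
    have hC := Finset.card_erase_add_one hb
    have := ih _ _ _ _ (h.contract hne.symm h₁ h₂) (by omega) (by omega)
    omega
  · set U := (A ∪ C).filter (fun i => i ≠ a₁ ∧ i ≠ a₂ ∧ i ∉ K) with hU
    have ha₃U : a₃ ∈ U := Finset.mem_filter.2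
      ⟨Finset.mem_union_left _ ha₃, h31, h32, fun hc => hAC ha₃ (hKC _ hc)⟩
    set Q := Relation.ReflTransGen
      (fun i j => i ∈ U ∧ j ∈ U ∧ ((i, j) ∈ E ∨ (j, i) ∈ E)) a₃ with hQ
    have hQU : ∀ i, Q i → i ∈ U := by
      intro i hi
      rcases Relation.ReflTransGen.cases_tail hi with rfl | ⟨j, -, hj⟩
      exacts [ha₃U, hj.2.1]
    by_cases hall : ∀ i ∈ U, Q i
    · refine absurd (h.hasK33Minor_of_linked hne.symm ha₁ ha₂ hK3 (fun c hc => ?_)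
        (Finset.filter_subset _ _) (by simp) (by simp)
        (fun c hc hcU => (Finset.mem_filter.1 hcU).2.2.2 hc) ha₃U hall) hG
      obtain ⟨a, h1, h2, hac⟩ := exists_third_neighbor (a₁ := a₁) (a₂ := a₂) (hdeg c (hKC c hc))
      have haA := (h.mem_sides _ _ hac).1
      exact ⟨(hK c hc).1, (hK c hc).2, a, Finset.mem_filter.2
        ⟨Finset.mem_union_left _ haA, h1, h2, fun hc => hAC haA (hKC _ hc)⟩, hac⟩
    · push Not at hall
      obtain ⟨j, hjU, hQj⟩ := hall
      obtain ⟨hj, hj₁, hj₂, hjK⟩ := Finset.mem_filter.1 hjU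
      refine h.card_le_of_separation ih hne.symm ha₁ ha₂ hK hK3 Q
        (fun hq => (Finset.mem_filter.1 (hQU _ hq)).2.1 rfl)
        (fun hq => (Finset.mem_filter.1 (hQU _ hq)).2.2.1 rfl)
        (fun c hc hq => (Finset.mem_filter.1 (hQU _ hq)).2.2.2 hc) ?_
        ⟨a₃, Finset.mem_union_left _ ha₃, .refl⟩ ⟨j, hj, hj₁, hj₂, hjK, hQj⟩
      intro a c hac h1 h2 hcK
      obtain ⟨haA, hcC⟩ := h.mem_sides _ _ hac
      have haU : a ∈ U := Finset.mem_filter.2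
        ⟨Finset.mem_union_left _ haA, h1, h2, fun hc => hAC haA (hKC _ hc)⟩
      have hcU : c ∈ U := Finset.mem_filter.2
        ⟨Finset.mem_union_right _ hcC, fun he => hAC ha₁ (he ▸ hcC), fun he => hAC ha₂ (he ▸ hcC),
          hcK⟩
      exact ⟨fun hq => hq.tail ⟨haU, hcU, Or.inl hac⟩, fun hq => hq.tail ⟨hcU, haU, Or.inr hac⟩⟩

lemma exists_degree_le_three (h : IsBipartiteModel G X A C E) (hlt : E.card < 4 * C.card) :
    ∃ c ∈ C, (E.filter (fun p => p.2 = c)).card ≤ 3 := by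
  by_contra! hall
  have := Finset.mul_card_image_le_card_of_maps_to (f := Prod.snd) (s := E) (t := C)
    (fun p hp => (h.mem_sides p.1 p.2 hp).2) 4 (fun c hc => hall c hc)
  omega

/-- A bipartite minor with `n ≥ 3` branch sets of a graph without `K₃,₃` minor has at most
`2 n - 4` edges. -/
theorem card_add_four_le (hG : ¬ HasK33Minor G) (h : IsBipartiteModel G X A C E)
    (hn : 3 ≤ A.card + C.card) : E.card + 4 ≤ 2 * (A.card + C.card) := by
  induction hN : A.card + C.card + E.card using Nat.strong_induction_on
    generalizing X A C E with
  | _ N ihN =>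
  by_contra! hcon
  have hmul := h.card_le_mul
  have hn5 : 5 ≤ A.card + C.card := by
    by_contra! hlt
    have hA : A.card ≤ 4 := by omega
    have hC : C.card ≤ 4 := by omega
    interval_cases A.card <;> interval_cases C.card <;> omega
  have hE : E.card + 3 ≤ 2 * (A.card + C.card) := by
    by_contra! hlt
    obtain ⟨p, hp⟩ := Finset.card_pos.1 (by omega : 0 < E.card)
    have hc := Finset.card_erase_add_one hp
    have := ihN (A.card + C.card + (E.erase p).card) (by omega)
      (h.mono subset_rfl subset_rfl (Finset.erase_subset p E)
        fun a c hac => h.mem_sides a c (Finset.mem_of_mem_erase hac)) hn rfl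
    omega
  have ih : SmallerBound G (A.card + C.card) ι := by
    intro X' A' C' E' h' hlt hn'
    by_contra! hcon'
    obtain ⟨E'', hsub, hcard⟩ := Finset.exists_subset_card_eq
      (show 2 * (A'.card + C'.card) - 3 ≤ E'.card by omega)
    have := ihN (A'.card + C'.card + E''.card) (by omega)
      (h'.mono subset_rfl subset_rfl hsub fun a c hac => h'.mem_sides a c (hsub hac)) hn' rfl
    omega
  have hdegC := fun c => h.three_le_degree ih (by omega) hcon (c := c)
  have ih' : SmallerBound G (C.card + A.card) ι := by rwa [add_comm]
  have hswap : (E.map (Equiv.prodComm ι ι).toEmbedding).card = E.card := Finset.card_map _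
  have hdegA := fun a => h.swap.three_le_degree ih' (by omega) (by omega) (c := a)
  rcases Nat.lt_or_ge E.card (4 * C.card) with hlt | hge
  · obtain ⟨b, hb, hb3⟩ := h.exists_degree_le_three hlt
    have := h.card_le_of_degree_three hG ih hn5 hdegC hb (le_antisymm hb3 (hdegC b hb))
    omega
  · obtain ⟨b, hb, hb3⟩ := h.swap.exists_degree_le_three (by omega)
    have := h.swap.card_le_of_degree_three hG ih' (by omega) hdegA hb
      (le_antisymm hb3 (hdegA b hb))
    omega

end IsBipartiteModel


/-- The set of vertices outside `Z` with a neighbour in `Z`. -/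
def outerNeighbors (G : SimpleGraph V) (Z : Set V) : Set V :=
  {s | s ∉ Z ∧ ∃ v ∈ Z, G.Adj s v}

lemma IsCompOf.outerNeighbors_subset {G : SimpleGraph V} {S Z : Set V} (h : IsCompOf G S Z) :
    outerNeighbors G Z ⊆ S := by
  rintro s ⟨hs, v, hv, hsv⟩
  by_contra hsS
  exact hs (h.2.2.2 v hv s hsS hsv.symm)

lemma isCompOf_outerNeighbors {G : SimpleGraph V} {Z : Set V} (h : (G.induce Z).Connected) :
    IsCompOf G (outerNeighbors G Z) Z := by
  refine ⟨Set.nonempty_coe_sort.1 h.nonempty, fun v hv hn => hn.1 hv, h, ?_⟩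
  intro a ha b hb hab
  by_contra hbZ
  exact hb ⟨hbZ, a, ha, hab.symm⟩

lemma mem_of_reachable_induce {G : SimpleGraph V} {S Y : Set V}
    (hY : ∀ a ∈ Y, ∀ b ∈ S, G.Adj a b → b ∈ Y) {x y : S} (h : (G.induce S).Reachable x y)
    (hx : (x : V) ∈ Y) : (y : V) ∈ Y := by
  obtain ⟨p⟩ := h
  induction p with
  | nil => exact hx
  | cons hadj _ ih => exact ih (hY _ hx _ (Subtype.coe_prop _) hadj)

lemma IsCompOf.subset_of_mem {G : SimpleGraph V} {S Y Z : Set V} (hY : IsCompOf G S Y)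
    (hZ : IsCompOf G S Z) {x : V} (hxY : x ∈ Y) (hxZ : x ∈ Z) : Z ⊆ Y := fun y hy =>
  mem_of_reachable_induce (fun a ha b hb hab => hY.2.2.2 a ha b (hZ.2.1 hb) hab)
    (hZ.2.2.1.preconnected ⟨x, hxZ⟩ ⟨y, hy⟩) hxY

lemma IsCompOf.disjoint {G : SimpleGraph V} {S Y Z : Set V} (hY : IsCompOf G S Y)
    (hZ : IsCompOf G S Z) (hne : Y ≠ Z) : Disjoint Y Z :=
  Set.disjoint_left.2 fun _ hxY hxZ =>
    hne ((hZ.subset_of_mem hY hxZ hxY).antisymm (hY.subset_of_mem hZ hxY hxZ))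

lemma isCompOf_image_supp {G : SimpleGraph V} {S : Set V}
    (c : (G.induce Sᶜ).ConnectedComponent) : IsCompOf G S (Subtype.val '' c.supp) := by
  refine ⟨c.nonempty_supp.image _, ?_, ?_, ?_⟩
  · rintro _ ⟨x, -, rfl⟩
    exact x.2
  · let f : c.toSimpleGraph →g G.induce (Subtype.val '' c.supp) :=
      ⟨fun x => ⟨x.1.1, x.1, x.2, rfl⟩, fun h => h⟩
    refine c.connected_toSimpleGraph.map f ?_
    rintro ⟨_, x, hx, rfl⟩
    exact ⟨⟨x, hx⟩, rfl⟩
  · rintro _ ⟨x, hx, rfl⟩ b hb hab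
    refine ⟨⟨b, hb⟩, ?_, rfl⟩
    exact c.mem_supp_of_adj_mem_supp hx hab

lemma not_preconnected_outerNeighbors {G : SimpleGraph V} {Z : Set V} (hZ : Z.Nonempty)
    {w : V} (hw : w ∉ Z) (hw' : w ∉ outerNeighbors G Z) :
    ¬ (G.induce (outerNeighbors G Z)ᶜ).Preconnected := by
  intro h
  obtain ⟨z, hz⟩ := hZ
  refine hw (mem_of_reachable_induce (Y := Z) ?_ (h ⟨z, fun hn => hn.1 hz⟩ ⟨w, hw'⟩) hz)
  intro a ha b hb hab
  by_contra hbZ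
  exact hb ⟨hbZ, a, ha, hab.symm⟩

lemma IsKConnected.le_ncard_outerNeighbors [Finite V] {G : SimpleGraph V} {k : ℕ}
    (hG : IsKConnected k G) {Z : Set V} (hZ : Z.Nonempty) {w : V} (hw : w ∉ Z)
    (hw' : w ∉ outerNeighbors G Z) : k ≤ (outerNeighbors G Z).ncard := by
  by_contra! hlt
  exact not_preconnected_outerNeighbors hZ hw hw' (hG.2 _ (Set.toFinite _) hlt).preconnected

lemma hasK33Minor_of_outerNeighbors_eq {G : SimpleGraph V} {T : Set V} (hT : T.ncard = 3)
    {Z : Fin 3 → Set V} (hZ : ∀ i, (G.induce (Z i)).Connected)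
    (hdisj : ∀ i j, i ≠ j → Disjoint (Z i) (Z j)) (hn : ∀ i, outerNeighbors G (Z i) = T) :
    HasK33Minor G := by
  obtain ⟨x, y, z, hxy, hxz, hyz, rfl⟩ := Set.ncard_eq_three.1 hT
  have hmem : ∀ i, (![x, y, z] i) ∈ ({x, y, z} : Set V) := by
    intro i; fin_cases i <;> simp
  have hinj : Function.Injective ![x, y, z] := by
    intro i j hij
    fin_cases i <;> fin_cases j <;> simp_all
  refine ⟨fun i => {![x, y, z] i}, Z, fun i => ?_, hZ, fun i j hij => ?_, hdisj,
    fun i j => ?_, fun i j => ?_⟩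
  · simp
  · simpa using fun h => hij (hinj h)
  · have := hmem i
    rw [← hn j] at this
    exact Set.disjoint_singleton_left.2 this.1
  · have := hmem i
    rw [← hn j] at this
    obtain ⟨-, v, hv, hadj⟩ := this
    exact ⟨_, rfl, v, hv, hadj⟩

/-- Two components of a cutset of a 3-connected graph without `K₃,₃` minor which are attached to
the same three vertices cover everything else. -/
lemma mem_of_outerNeighbors_eq [Finite V] {G : SimpleGraph V} (hG : ¬ HasK33Minor G)
    (h3 : IsKConnected 3 G) {T Y Z : Set V} (hT : T.ncard = 3)
    (hYc : (G.induce Y).Connected) (hZc : (G.induce Z).Connected) (hYZ : Disjoint Y Z)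
    (hY : outerNeighbors G Y = T) (hZ : outerNeighbors G Z = T) {w : V} (hw : w ∉ T) :
    w ∈ Y ∨ w ∈ Z := by
  by_contra! hn
  have hYT : IsCompOf G T Y := hY ▸ isCompOf_outerNeighbors hYc
  have hZT : IsCompOf G T Z := hZ ▸ isCompOf_outerNeighbors hZc
  set c := (G.induce Tᶜ).connectedComponentMk ⟨w, hw⟩
  set W : Set V := Subtype.val '' c.supp
  have hW : IsCompOf G T W := isCompOf_image_supp c
  have hwW : w ∈ W := ⟨⟨w, hw⟩, rfl, rfl⟩
  have hYW : Disjoint Y W := hYT.disjoint hW fun h => hn.1 (h ▸ hwW)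
  have hZW : Disjoint Z W := hZT.disjoint hW fun h => hn.2 (h ▸ hwW)
  obtain ⟨y, hy⟩ := hYT.1
  have hle := h3.le_ncard_outerNeighbors hW.1 (Set.disjoint_left.1 hYW hy)
    (fun h => hYT.2.1 hy (hW.outerNeighbors_subset h))
  have hWT : outerNeighbors G W = T :=
    Set.eq_of_subset_of_ncard_le hW.outerNeighbors_subset (by omega) (Set.toFinite _)
  refine hG (hasK33Minor_of_outerNeighbors_eq hT (Z := ![Y, Z, W]) ?_ ?_ ?_)
  · intro i; fin_cases i
    exacts [hYc, hZc, hW.2.2.1]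
  · intro i j hij
    fin_cases i <;> fin_cases j <;> simp_all [disjoint_comm]
  · intro i; fin_cases i
    exacts [hY, hZ, hWT]

/-- Counting the pairs of a component of `G - S` and a vertex of `S` attached to it. -/
lemma sum_ncard_outerNeighbors_add_four_le [Fintype V] {G : SimpleGraph V}
    (hG : ¬ HasK33Minor G) {S : Set V} [Fintype (G.induce Sᶜ).ConnectedComponent]
    (hS : 3 ≤ S.ncard) :
    ∑ c : (G.induce Sᶜ).ConnectedComponent, (outerNeighbors G (Subtype.val '' c.supp)).ncard + 4 ≤
      2 * (S.ncard + Fintype.card (G.induce Sᶜ).ConnectedComponent) := by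
  classical
  let X : V ⊕ (G.induce Sᶜ).ConnectedComponent → Set V :=
    Sum.elim (fun s => {s}) (fun c => Subtype.val '' c.supp)
  let N : (G.induce Sᶜ).ConnectedComponent → Finset V :=
    fun c => (outerNeighbors G (Subtype.val '' c.supp)).toFinset
  have hmodel : IsBipartiteModel G X (S.toFinset.map Function.Embedding.inl)
      (Finset.univ.map Function.Embedding.inr)
      ((Finset.univ.sigma N).image fun p => (Sum.inl p.2, Sum.inr p.1)) := by
    refine ⟨?_, ?_, ?_, ?_, ?_⟩
    · rw [Finset.disjoint_left]
      simp
    · intro a c hac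
      simp only [Finset.mem_image, Finset.mem_sigma, Finset.mem_univ, true_and, Prod.mk.injEq,
        Sigma.exists] at hac
      obtain ⟨c', s, hs, rfl, rfl⟩ := hac
      simpa using (isCompOf_image_supp c').outerNeighbors_subset (Set.mem_toFinset.1 hs)
    · rintro (s | c) -
      · simp [X]
      · exact (isCompOf_image_supp c).2.2.1
    · have hsc : ∀ s ∈ S, ∀ c : (G.induce Sᶜ).ConnectedComponent, s ∉ Subtype.val '' c.supp :=
        fun s hs c hsc => (isCompOf_image_supp c).2.1 hsc hs
      rintro (s | c) hi (s' | c') hj hne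
      · simpa [X] using fun h : s = s' => hne (by rw [h])
      · exact Set.disjoint_singleton_left.2 (hsc s (by simpa using hi) c')
      · exact Set.disjoint_singleton_right.2 (hsc s' (by simpa using hj) c)
      · refine Set.disjoint_image_iff Subtype.val_injective |>.2 ?_
        exact pairwise_disjoint_supp_connectedComponent _
          fun h => hne (by rw [h])
    · intro a c hac
      simp only [Finset.mem_image, Finset.mem_sigma, Finset.mem_univ, true_and, Prod.mk.injEq,
        Sigma.exists] at hac
      obtain ⟨c', s, hs, rfl, rfl⟩ := hac
      obtain ⟨-, v, hv, hadj⟩ := Set.mem_toFinset.1 hs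
      exact ⟨s, rfl, v, hv, hadj⟩
  have hcard := hmodel.card_add_four_le hG (by
    rw [Finset.card_map, ← Set.ncard_eq_toFinset_card']
    omega)
  rw [Finset.card_image_of_injective, Finset.card_sigma, Finset.card_map, Finset.card_map,
    ← Set.ncard_eq_toFinset_card', Finset.card_univ] at hcard
  · simpa only [N, ← Set.ncard_eq_toFinset_card'] using hcard
  · rintro ⟨c, s⟩ ⟨c', s'⟩ h
    simp only [Prod.mk.injEq, Sum.inl.injEq, Sum.inr.injEq] at h
    rw [h.1, h.2]

theorem IsKConnected.card_connectedComponent_add_two_le [Fintype V] {G : SimpleGraph V}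
    (h3 : IsKConnected 3 G) (hG : ¬ HasK33Minor G) {d : ℕ} (hd : 4 ≤ d)
    (hcuts : {S : Set V | IsThreeCut G S}.ncard ≤ d) {S : Set V}
    (hS : ¬ (G.induce Sᶜ).Preconnected) :
    Nat.card (G.induce Sᶜ).ConnectedComponent + 2 ≤ S.ncard + d / 2 := by
  classical
  have hS3 : 3 ≤ S.ncard := by
    by_contra! hlt
    exact hS (h3.2 S (Set.toFinite _) hlt).preconnected
  let _ : Fintype (G.induce Sᶜ).ConnectedComponent := Fintype.ofFinite _
  rw [Nat.card_eq_fintype_card]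
  set Z : (G.induce Sᶜ).ConnectedComponent → Set V := fun c => Subtype.val '' c.supp
  have hcomp : ∀ c, IsCompOf G S (Z c) := isCompOf_image_supp
  have hdisj : ∀ c c', c ≠ c' → Disjoint (Z c) (Z c') := fun c c' hne =>
    (Set.disjoint_image_iff Subtype.val_injective).2
      (pairwise_disjoint_supp_connectedComponent _ hne)
  have hcut : ∀ c, ¬ (G.induce (outerNeighbors G (Z c))ᶜ).Preconnected := by
    intro c
    obtain ⟨c', hne⟩ : ∃ c', c' ≠ c := by
      by_contra! hall
      refine hS fun x y => ConnectedComponent.exact ?_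
      rw [hall (connectedComponentMk _ x), hall (connectedComponentMk _ y)]
    obtain ⟨w, hw⟩ := (hcomp c').1
    exact not_preconnected_outerNeighbors (hcomp c).1
      (Set.disjoint_left.1 (hdisj _ _ hne) hw)
      fun h => (hcomp c').2.1 hw ((hcomp c).outerNeighbors_subset h)
  have hthree : ∀ c, 3 ≤ (outerNeighbors G (Z c)).ncard := by
    intro c
    by_contra! hlt
    exact hcut c (h3.2 _ (Set.toFinite _) hlt).preconnected
  set F : Finset (G.induce Sᶜ).ConnectedComponent :=
    Finset.univ.filter fun c => (outerNeighbors G (Z c)).ncard = 3 with hF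
  by_cases hinj : Set.InjOn (fun c => outerNeighbors G (Z c)) F
  · have hFd : F.card ≤ d := by
      refine le_trans ?_ hcuts
      rw [← Set.ncard_coe_finset]
      exact Set.ncard_le_ncard_of_injOn _
        (fun c hc => ⟨(Finset.mem_filter.1 hc).2, hcut c⟩) hinj (Set.toFinite _)
    have hsum : ∑ c, (outerNeighbors G (Z c)).ncard + 4 ≤
        2 * (S.ncard + Fintype.card (G.induce Sᶜ).ConnectedComponent) :=
      sum_ncard_outerNeighbors_add_four_le hG hS3
    have hlow : ∑ _c : (G.induce Sᶜ).ConnectedComponent, 4 ≤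
        ∑ c, ((outerNeighbors G (Z c)).ncard +
          if (outerNeighbors G (Z c)).ncard = 3 then 1 else 0) :=
      Finset.sum_le_sum fun c _ => by
        have := hthree c
        split_ifs <;> omega
    rw [Finset.sum_add_distrib, ← Finset.card_filter, Finset.sum_const, Finset.card_univ,
      smul_eq_mul, ← hF] at hlow
    omega
  · simp only [Set.InjOn] at hinj
    push Not at hinj
    obtain ⟨c₁, hc₁, c₂, -, heq, hne⟩ := hinj
    have hT := (Finset.mem_filter.1 hc₁).2
    have huniv : (Finset.univ : Finset (G.induce Sᶜ).ConnectedComponent) ⊆ {c₁, c₂} := by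
      intro c _
      obtain ⟨w, hw⟩ := (hcomp c).1
      have hcase := mem_of_outerNeighbors_eq hG h3 hT (hcomp c₁).2.2.1 (hcomp c₂).2.2.1
        (hdisj _ _ hne) rfl heq.symm
        (fun h => (hcomp c).2.1 hw ((hcomp c₁).outerNeighbors_subset h))
      rw [Finset.mem_insert, Finset.mem_singleton]
      refine hcase.imp (fun h => ?_) fun h => ?_ <;>
      · by_contra hcc
        exact Set.disjoint_left.1 (hdisj _ _ hcc) hw h
    have := (Finset.card_le_card huniv).trans Finset.card_le_two
    rw [Finset.card_univ] at this
    omega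

/-- For a 3-connected planar graph with at most `d ≥ 4` 3-cuts and any cutset `S`, the
number of components of `G - S` is at most `|S| - 2 + ⌊d/2⌋`; in particular `G` is
1-tough if `d ≤ 5` and has scattering number at most 1 if `d ≤ 7`. -/
theorem stmt18 [Fintype V] (G : SimpleGraph V)
    (hP : IsPlanar G) (h3 : IsKConnected 3 G)
    (d : ℕ) (hd : 4 ≤ d) (hcuts : {S : Set V | IsThreeCut G S}.ncard ≤ d) :
    (∀ S : Set V, ¬ (G.induce (Sᶜ : Set V)).Preconnected →
      Nat.card (G.induce (Sᶜ : Set V)).ConnectedComponent + 2 ≤ S.ncard + d / 2) ∧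
    (d ≤ 5 → ∀ S : Set V, ¬ (G.induce (Sᶜ : Set V)).Preconnected →
      Nat.card (G.induce (Sᶜ : Set V)).ConnectedComponent ≤ S.ncard) ∧
    (d ≤ 7 → ∀ S : Set V, ¬ (G.induce (Sᶜ : Set V)).Preconnected →
      Nat.card (G.induce (Sᶜ : Set V)).ConnectedComponent ≤ S.ncard + 1) := by
  have hbound := fun (S : Set V) (hS : ¬ (G.induce (Sᶜ : Set V)).Preconnected) =>
    h3.card_connectedComponent_add_two_le hP.not_hasK33Minor hd hcuts hS
  refine ⟨hbound, fun h5 S hS => ?_, fun h7 S hS => ?_⟩ <;>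
  · have := hbound S hS
    omega
end
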